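/- arXiv:1408.3462 — 9 statements merged into one kernel-verified Lean document; each statement's English description precedes it below -/
import Mathlib

section
/- Let k ≥ 1 and let l₀, l₁ ∈ ℝ^k have strictly positive entries. Then the infimum, over all x, y ∈ ℝ^k with nonnegative entries satisfying Σ_i √(x_i y_i) ≥ 1, of Σ_i l₀ᵢ x_i + Σ_i l₁ᵢ y_i, equals min_i 2√(l₀ᵢ · l₁ᵢ), and the infimum is attained. -/
/-- The polar of the classical fidelity: for strictly positive vectors `l₀, l₁ ∈ ℝ^k`,
the minimum of `∑ l₀ᵢ xᵢ + ∑ l₁ᵢ yᵢ` over nonnegative `x, y` with classical fidelity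
`∑ √(xᵢ yᵢ) ≥ 1` equals `minᵢ 2√(l₀ᵢ l₁ᵢ)`. -/
theorem stmt_7 {k : ℕ} (hk : 1 ≤ k) (l₀ l₁ : Fin k → ℝ)
    (h0 : ∀ i, 0 < l₀ i) (h1 : ∀ i, 0 < l₁ i) :
    IsLeast {t : ℝ | ∃ x y : Fin k → ℝ, (∀ i, 0 ≤ x i) ∧ (∀ i, 0 ≤ y i) ∧
        1 ≤ ∑ i, Real.sqrt (x i * y i) ∧
        t = (∑ i, l₀ i * x i) + (∑ i, l₁ i * y i)}
      (⨅ i, 2 * Real.sqrt (l₀ i * l₁ i)) := by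
  haveI : Nonempty (Fin k) := ⟨⟨0, hk⟩⟩
  constructor
  · obtain ⟨j, hj⟩ := exists_eq_ciInf_of_finite (f := fun i => 2 * Real.sqrt (l₀ i * l₁ i))
    have ha : 0 < Real.sqrt (l₀ j) := Real.sqrt_pos.2 (h0 j)
    have hb : 0 < Real.sqrt (l₁ j) := Real.sqrt_pos.2 (h1 j)
    have ha2 := Real.mul_self_sqrt (h0 j).le
    have hb2 := Real.mul_self_sqrt (h1 j).le
    refine ⟨fun i => if i = j then Real.sqrt (l₁ j) / Real.sqrt (l₀ j) else 0,
      fun i => if i = j then Real.sqrt (l₀ j) / Real.sqrt (l₁ j) else 0, ?_, ?_, ?_, ?_⟩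
    · intro i
      dsimp only
      split_ifs <;> positivity
    · intro i
      dsimp only
      split_ifs <;> positivity
    · refine le_trans ?_ (Finset.single_le_sum (fun i _ => Real.sqrt_nonneg _)
        (Finset.mem_univ j))
      simp only [if_true]
      rw [div_mul_div_cancel₀ ha.ne', div_self hb.ne', Real.sqrt_one]
    · rw [← hj]
      simp only [mul_ite, mul_zero, Finset.sum_ite_eq', Finset.mem_univ, if_true]
      rw [Real.sqrt_mul (h0 j).le]
      have e1 : l₀ j * (Real.sqrt (l₁ j) / Real.sqrt (l₀ j))
          = Real.sqrt (l₀ j) * Real.sqrt (l₁ j) := by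
        rw [mul_div_assoc', div_eq_iff ha.ne']
        linear_combination (-Real.sqrt (l₁ j)) * ha2
      have e2 : l₁ j * (Real.sqrt (l₀ j) / Real.sqrt (l₁ j))
          = Real.sqrt (l₀ j) * Real.sqrt (l₁ j) := by
        rw [mul_div_assoc', div_eq_iff hb.ne']
        linear_combination (-Real.sqrt (l₀ j)) * hb2
      rw [e1, e2]
      ring
  · rintro t ⟨x, y, hx, hy, hs, rfl⟩
    set m := ⨅ i, 2 * Real.sqrt (l₀ i * l₁ i) with hm
    have hm0 : 0 ≤ m := Real.iInf_nonneg fun i => by positivity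
    have hmi : ∀ i, m ≤ 2 * Real.sqrt (l₀ i * l₁ i) := fun i =>
      ciInf_le (Set.finite_range _).bddBelow i
    calc m ≤ m * ∑ i, Real.sqrt (x i * y i) := le_mul_of_one_le_right hm0 hs
      _ = ∑ i, m * Real.sqrt (x i * y i) := Finset.mul_sum _ _ _
      _ ≤ ∑ i, (l₀ i * x i + l₁ i * y i) := by
        refine Finset.sum_le_sum fun i _ => ?_
        refine (mul_le_mul_of_nonneg_right (hmi i) (Real.sqrt_nonneg _)).trans ?_
        have hp : 0 ≤ l₀ i * x i := mul_nonneg (h0 i).le (hx i)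
        have hq : 0 ≤ l₁ i * y i := mul_nonneg (h1 i).le (hy i)
        rw [mul_assoc, ← Real.sqrt_mul (mul_pos (h0 i) (h1 i)).le,
          mul_mul_mul_comm, Real.sqrt_mul hp]
        nlinarith [sq_nonneg (Real.sqrt (l₀ i * x i) - Real.sqrt (l₁ i * y i)),
          Real.sq_sqrt hp, Real.sq_sqrt hq]
      _ = _ := Finset.sum_add_distrib
end

section
/- Let L₀ and L₁ be n×n positive definite matrices over ℂ. Then the infimum of tr(L₀·X) + tr(L₁·Y), taken over all pairs of n×n positive semidefinite matrices X, Y for which there exists a Hermitian n×n matrix C with the block matrix [[X, C],[C, Y]] positive semidefinite and Re(tr C) ≥ 1, equals the minimum over all n×n density matrices ρ of 2·√(tr(ρ·L₀) · tr(ρ·L₁)), and this minimum over density matrices is attained. -/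
open Matrix ComplexOrder
open scoped Classical

lemma aux_real {b p q : ℝ} (hp : 0 ≤ p) (hq : 0 ≤ q)
    (h : ∀ a : ℝ, 0 < a → b ≤ a * p + a⁻¹ * q) : b ≤ 2 * Real.sqrt (p * q) := by
  have key : ∀ e : ℝ, 0 < e → b ≤ 2 * Real.sqrt ((p + e) * (q + e)) := by
    intro e he
    have hs : 0 < Real.sqrt (p + e) := Real.sqrt_pos.2 (by linarith)
    have ht : 0 < Real.sqrt (q + e) := Real.sqrt_pos.2 (by linarith)
    have h1 := h (Real.sqrt (q + e) / Real.sqrt (p + e)) (by positivity)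
    rw [Real.sqrt_mul (by linarith)]
    have es : Real.sqrt (p + e) * Real.sqrt (p + e) = p + e := Real.mul_self_sqrt (by linarith)
    have et : Real.sqrt (q + e) * Real.sqrt (q + e) = q + e := Real.mul_self_sqrt (by linarith)
    set s := Real.sqrt (p + e)
    set t := Real.sqrt (q + e)
    have h2 : t / s * p ≤ t / s * (s * s) :=
      mul_le_mul_of_nonneg_left (by linarith) (by positivity)
    have h3 : (t / s)⁻¹ * q ≤ (t / s)⁻¹ * (t * t) :=
      mul_le_mul_of_nonneg_left (by linarith) (by positivity)
    have h4 : t / s * (s * s) = s * t := by field_simp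
    have h5 : (t / s)⁻¹ * (t * t) = s * t := by field_simp
    linarith
  have hc : Continuous fun e : ℝ => 2 * Real.sqrt ((p + e) * (q + e)) := by fun_prop
  have ht : Filter.Tendsto (fun e : ℝ => 2 * Real.sqrt ((p + e) * (q + e)))
      (nhdsWithin 0 (Set.Ioi 0)) (nhds (2 * Real.sqrt (p * q))) := by
    have := (hc.tendsto 0).mono_left (nhdsWithin_le_nhds (s := Set.Ioi 0))
    simpa using this
  refine ge_of_tendsto ht ?_
  filter_upwards [self_mem_nhdsWithin] with e he using key e he

lemma aux_trace_nonneg {n : ℕ} {A B : Matrix (Fin n) (Fin n) ℂ} (hA : A.PosSemidef)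
    (hB : B.PosSemidef) : 0 ≤ (A * B).trace.re := by
  open scoped MatrixOrder in
  obtain ⟨y, rfl⟩ := CStarAlgebra.nonneg_iff_eq_star_mul_self.mp hB.nonneg
  rw [star_eq_conjTranspose, ← Matrix.mul_assoc, Matrix.trace_mul_comm, ← Matrix.mul_assoc]
  exact (Complex.le_def.1 (hA.mul_mul_conjTranspose_same y).trace_nonneg).1

lemma aux_feas {n : ℕ} {ρ : Matrix (Fin n) (Fin n) ℂ} (hρ : ρ.PosSemidef) {a : ℝ} (ha : 0 < a) :
    (Matrix.fromBlocks ((a : ℂ) • ρ) ρ ρ (((a⁻¹ : ℝ) : ℂ) • ρ)).PosSemidef := by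
  have hs : 0 < Real.sqrt a := Real.sqrt_pos.2 ha
  have h2 : ((Real.sqrt a : ℝ) : ℂ) * (Real.sqrt a : ℝ) = a := by
    rw [← Complex.ofReal_mul, Real.mul_self_sqrt ha.le]
  have h3 : ((Real.sqrt a : ℝ) : ℂ) ≠ 0 := by exact_mod_cast hs.ne'
  have := hρ.mul_mul_conjTranspose_same
    (Matrix.fromRows (((Real.sqrt a : ℝ) : ℂ) • (1 : Matrix (Fin n) (Fin n) ℂ))
      ((((Real.sqrt a)⁻¹ : ℝ) : ℂ) • (1 : Matrix (Fin n) (Fin n) ℂ)))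
  convert this using 1
  rw [Matrix.conjTranspose_fromRows_eq_fromCols_conjTranspose, Matrix.fromRows_mul,
    Matrix.fromRows_mul_fromCols]
  simp only [conjTranspose_smul, conjTranspose_one, Matrix.smul_mul, Matrix.mul_smul,
    Matrix.one_mul, Matrix.mul_one, smul_smul, RCLike.star_def, Complex.conj_ofReal]
  rw [h2]
  congr 1
  · rw [Complex.ofReal_inv, inv_mul_cancel₀ h3, one_smul]
  · rw [Complex.ofReal_inv, mul_inv_cancel₀ h3, one_smul]
  · rw [Complex.ofReal_inv, Complex.ofReal_inv, ← mul_inv, h2]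

lemma aux_simul {n : ℕ} {Y C : Matrix (Fin n) (Fin n) ℂ} (hY : Y.PosDef) (hC : C.IsHermitian) :
    ∃ (G : Matrix (Fin n) (Fin n) ℂ) (d : Fin n → ℝ), IsUnit G ∧ Y = G * Gᴴ ∧
      C = G * diagonal (fun i => (d i : ℂ)) * Gᴴ := by
  open scoped MatrixOrder in
  obtain ⟨B, hB⟩ := CStarAlgebra.nonneg_iff_eq_star_mul_self.mp hY.posSemidef.nonneg
  rw [star_eq_conjTranspose] at hB
  have hBu : IsUnit B.det := by
    have h1 := (Matrix.isUnit_iff_isUnit_det _).1 hY.isUnit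
    rw [hB, det_mul] at h1
    exact isUnit_of_mul_isUnit_right h1
  have hBu' : IsUnit Bᴴ.det := by rw [det_conjTranspose]; exact hBu.star
  have hH : (Bᴴ⁻¹ * C * B⁻¹).IsHermitian := by
    have := isHermitian_conjTranspose_mul_mul B⁻¹ hC
    rwa [conjTranspose_nonsing_inv] at this
  set U : Matrix (Fin n) (Fin n) ℂ := hH.eigenvectorUnitary.1 with hU
  have hUU : U * Uᴴ = 1 := Unitary.coe_mul_star_self hH.eigenvectorUnitary
  have hUU' : Uᴴ * U = 1 := mul_eq_one_comm.1 hUU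
  have hsp : Bᴴ⁻¹ * C * B⁻¹ = U * diagonal (fun i => (hH.eigenvalues i : ℂ)) * Uᴴ := by
    have := hH.spectral_theorem
    rw [Unitary.conjStarAlgAut_apply] at this
    exact this
  refine ⟨Bᴴ * U, hH.eigenvalues, ?_, ?_, ?_⟩
  · rw [Matrix.isUnit_iff_isUnit_det, det_mul]
    exact hBu'.mul (by
      have : IsUnit U := IsUnit.of_mul_eq_one _ hUU
      exact (Matrix.isUnit_iff_isUnit_det _).1 this)
  · rw [conjTranspose_mul, conjTranspose_conjTranspose, hB]
    calc Bᴴ * B = Bᴴ * (U * Uᴴ) * B := by rw [hUU, Matrix.mul_one]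
      _ = _ := by simp only [Matrix.mul_assoc]
  · rw [conjTranspose_mul, conjTranspose_conjTranspose]
    calc C = (Bᴴ * Bᴴ⁻¹) * C * (B⁻¹ * B) := by
          rw [mul_nonsing_inv _ hBu', nonsing_inv_mul _ hBu, Matrix.one_mul, Matrix.mul_one]
      _ = Bᴴ * (Bᴴ⁻¹ * C * B⁻¹) * B := by simp only [Matrix.mul_assoc]
      _ = Bᴴ * (U * diagonal (fun i => (hH.eigenvalues i : ℂ)) * Uᴴ) * B :=
          congrArg (fun M => Bᴴ * M * B) hsp
      _ = _ := by simp only [Matrix.mul_assoc]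

lemma aux_tr {n : ℕ} (L G : Matrix (Fin n) (Fin n) ℂ) (d : Fin n → ℝ) :
    (L * (G * diagonal (fun i => (d i : ℂ)) * Gᴴ)).trace.re =
      ∑ i, d i * (star (fun k => G k i) ⬝ᵥ L *ᵥ (fun k => G k i)).re := by
  rw [← Matrix.mul_assoc, Matrix.trace_mul_comm, ← Matrix.mul_assoc, ← Matrix.mul_assoc,
    Matrix.trace, Complex.re_sum]
  refine Finset.sum_congr rfl fun i _ => ?_
  rw [diag_apply, mul_diagonal, mul_comm, Complex.re_ofReal_mul]
  congr 2
  rw [Matrix.mul_assoc, Matrix.mul_apply]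
  rfl

lemma aux_main {n : ℕ} {L₀ L₁ : Matrix (Fin n) (Fin n) ℂ} (h0 : L₀.PosDef) (h1 : L₁.PosDef)
    {v : ℝ} (hv0 : 0 ≤ v)
    (hv : ∀ y : Fin n → ℂ, v * (star y ⬝ᵥ y).re ≤
      2 * Real.sqrt ((star y ⬝ᵥ L₀ *ᵥ y).re * (star y ⬝ᵥ L₁ *ᵥ y).re))
    {X Y C : Matrix (Fin n) (Fin n) ℂ} (hY : Y.PosSemidef) (hC : C.IsHermitian)
    (hb : (Matrix.fromBlocks X C C Y).PosSemidef) (ht : 1 ≤ C.trace.re) :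
    v ≤ (L₀ * X).trace.re + (L₁ * Y).trace.re := by
  have key : ∀ e : ℝ, 0 < e →
      v ≤ (L₀ * X).trace.re + (L₁ * Y).trace.re + e * L₁.trace.re := by
    intro e he
    have hE : ((e : ℂ) • (1 : Matrix (Fin n) (Fin n) ℂ)).PosDef :=
      PosDef.one.smul (by exact_mod_cast he)
    have hY' : (Y + (e : ℂ) • (1 : Matrix (Fin n) (Fin n) ℂ)).PosDef :=
      PosDef.posSemidef_add hY hE
    have hz : (Matrix.fromBlocks (0 : Matrix (Fin n) (Fin n) ℂ) 0 0
        ((e : ℂ) • (1 : Matrix (Fin n) (Fin n) ℂ))).PosSemidef := by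
      have hd := hE.posSemidef.mul_mul_conjTranspose_same
        (Matrix.fromRows (0 : Matrix (Fin n) (Fin n) ℂ) (1 : Matrix (Fin n) (Fin n) ℂ))
      convert hd using 1
      rw [Matrix.conjTranspose_fromRows_eq_fromCols_conjTranspose, Matrix.fromRows_mul,
        Matrix.fromRows_mul_fromCols]
      simp
    have hb' := hb.add hz
    rw [Matrix.fromBlocks_add] at hb'
    simp only [add_zero] at hb'
    set Y' := Y + (e : ℂ) • (1 : Matrix (Fin n) (Fin n) ℂ) with hYd
    have hL : (L₁ * Y').trace.re = (L₁ * Y).trace.re + e * L₁.trace.re := by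
      rw [hYd]; simp [Matrix.mul_add]
    rw [add_assoc, ← hL]
    obtain ⟨G, d, hG, hYG, hCG⟩ := aux_simul hY' hC
    have : Invertible Y' := hY'.isUnit.invertible
    have hsch : (X - C * Y'⁻¹ * C).PosSemidef := by
      have := (PosDef.fromBlocks₂₂ X C hY').1 (by rwa [hC.eq])
      rwa [hC.eq] at this
    have hGd : IsUnit G.det := (Matrix.isUnit_iff_isUnit_det _).1 hG
    have hGd' : IsUnit Gᴴ.det := by rw [det_conjTranspose]; exact hGd.star
    have hCC : C * Y'⁻¹ * C = G * diagonal (fun i => ((d i * d i : ℝ) : ℂ)) * Gᴴ := by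
      rw [hYG, hCG, Matrix.mul_inv_rev]
      calc _ = G * diagonal (fun i => (d i : ℂ)) * (Gᴴ * Gᴴ⁻¹) * (G⁻¹ * G) *
            diagonal (fun i => (d i : ℂ)) * Gᴴ := by simp only [Matrix.mul_assoc]
        _ = _ := by
          rw [mul_nonsing_inv _ hGd', nonsing_inv_mul _ hGd, Matrix.mul_one, Matrix.mul_one,
            Matrix.mul_assoc G, diagonal_mul_diagonal]
          simp
    have hX := aux_trace_nonneg h0.posSemidef hsch
    rw [Matrix.mul_sub, Matrix.trace_sub, Complex.sub_re, hCC, aux_tr] at hX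
    have hYt : (L₁ * Y').trace.re =
        ∑ i, (star (fun k => G k i) ⬝ᵥ L₁ *ᵥ (fun k => G k i)).re := by
      have := aux_tr L₁ G (fun _ => 1)
      simp only [Complex.ofReal_one, one_mul, diagonal_one, Matrix.mul_one] at this
      rw [hYG, this]
    have hCt : C.trace.re = ∑ i, d i * (star (fun k => G k i) ⬝ᵥ (fun k => G k i)).re := by
      have := aux_tr 1 G d
      simp only [Matrix.one_mul, Matrix.one_mulVec] at this
      rw [hCG, this]
    have hsum : v * C.trace.re ≤
        ∑ i, (d i * d i * (star (fun k => G k i) ⬝ᵥ L₀ *ᵥ (fun k => G k i)).re +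
          (star (fun k => G k i) ⬝ᵥ L₁ *ᵥ (fun k => G k i)).re) := by
      rw [hCt, Finset.mul_sum]
      refine Finset.sum_le_sum fun i _ => ?_
      generalize (fun k => G k i) = y
      have hN : 0 ≤ (star y ⬝ᵥ y).re :=
        (Complex.le_def.1 (dotProduct_star_self_nonneg y)).1
      have hp : 0 ≤ (star y ⬝ᵥ L₀ *ᵥ y).re :=
        (Complex.le_def.1 (h0.posSemidef.dotProduct_mulVec_nonneg y)).1
      have hq : 0 ≤ (star y ⬝ᵥ L₁ *ᵥ y).re :=
        (Complex.le_def.1 (h1.posSemidef.dotProduct_mulVec_nonneg y)).1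
      have hvy := hv y
      rw [Real.sqrt_mul hp] at hvy
      have es := Real.mul_self_sqrt hp
      have et := Real.mul_self_sqrt hq
      set N := (star y ⬝ᵥ y).re
      set p := (star y ⬝ᵥ L₀ *ᵥ y).re
      set q := (star y ⬝ᵥ L₁ *ᵥ y).re
      have hst : 0 ≤ v * N := mul_nonneg hv0 hN
      have e1 : v * (d i * N) ≤ |d i| * (v * N) := by
        have := mul_le_mul_of_nonneg_right (le_abs_self (d i)) hst
        nlinarith
      have e2 : |d i| * (v * N) ≤ |d i| * (2 * (Real.sqrt p * Real.sqrt q)) :=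
        mul_le_mul_of_nonneg_left hvy (abs_nonneg _)
      have e3 := sq_nonneg (|d i| * Real.sqrt p - Real.sqrt q)
      have e4 : d i * d i = |d i| * |d i| := (abs_mul_abs_self _).symm
      rw [e4]
      nlinarith
    rw [Finset.sum_add_distrib, ← hYt] at hsum
    have : v ≤ v * C.trace.re := le_mul_of_one_le_right hv0 ht
    linarith
  have hT : 0 ≤ L₁.trace.re := (Complex.le_def.1 h1.posSemidef.trace_nonneg).1
  refine le_of_forall_pos_le_add fun e he => ?_
  refine (key (e / (L₁.trace.re + 1)) (by positivity)).trans ?_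
  have : e / (L₁.trace.re + 1) * L₁.trace.re ≤ e := by
    rw [div_mul_eq_mul_div, div_le_iff₀ (by positivity)]
    nlinarith
  linarith

lemma aux_exists {n : ℕ} (hn : 0 < n) (L₀ L₁ : Matrix (Fin n) (Fin n) ℂ) :
    ∃ (v : ℝ) (ρ : Matrix (Fin n) (Fin n) ℂ), 0 ≤ v ∧ ρ.PosSemidef ∧ ρ.trace = 1 ∧
      v = 2 * Real.sqrt (((ρ * L₀).trace).re * ((ρ * L₁).trace).re) ∧
      ∀ y : Fin n → ℂ, v * (star y ⬝ᵥ y).re ≤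
      2 * Real.sqrt ((star y ⬝ᵥ L₀ *ᵥ y).re * (star y ⬝ᵥ L₁ *ᵥ y).re) := by
  have : Nonempty (Fin n) := ⟨⟨0, hn⟩⟩
  have hpos : ∀ y : Fin n → ℂ, y ≠ 0 → 0 < star y ⬝ᵥ y := fun y hy =>
    dotProduct_star_self_pos_iff.2 hy
  have hposr : ∀ y : Fin n → ℂ, y ≠ 0 → 0 < (star y ⬝ᵥ y).re := fun y hy =>
    (Complex.lt_def.1 (hpos y hy)).1
  have hne : ∀ y ∈ Metric.sphere (0 : Fin n → ℂ) 1, y ≠ 0 := by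
    rintro y hy rfl
    simp at hy
  obtain ⟨w, hw, hmin⟩ := (isCompact_sphere (0 : Fin n → ℂ) 1).exists_isMinOn
    (NormedSpace.sphere_nonempty.2 zero_le_one)
    (f := fun y => 2 * Real.sqrt ((star y ⬝ᵥ L₀ *ᵥ y).re * (star y ⬝ᵥ L₁ *ᵥ y).re) /
      (star y ⬝ᵥ y).re) (by
        refine ContinuousOn.div ?_ ?_ fun y hy => (hposr y (hne y hy)).ne'
        · apply Continuous.continuousOn
          simp only [dotProduct, mulVec, Pi.star_apply]
          fun_prop
        · apply Continuous.continuousOn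
          simp only [dotProduct, Pi.star_apply]
          fun_prop)
  have hw0 := hne w hw
  have hN := hposr w hw0
  have hNc : star w ⬝ᵥ w = (((star w ⬝ᵥ w).re : ℝ) : ℂ) :=
    Complex.eq_re_of_ofReal_le (r := 0) (by simpa using (hpos w hw0).le)
  set N := (star w ⬝ᵥ w).re with hNd
  have htr : ∀ L : Matrix (Fin n) (Fin n) ℂ,
      ((((N⁻¹ : ℝ) : ℂ) • vecMulVec w (star w)) * L).trace.re =
        N⁻¹ * (star w ⬝ᵥ L *ᵥ w).re := by
    intro L
    rw [Matrix.smul_mul, Matrix.trace_smul, smul_eq_mul, Complex.re_ofReal_mul, vecMulVec_mul,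
      trace_vecMulVec, dotProduct_comm, ← dotProduct_mulVec]
  refine ⟨_, ((N⁻¹ : ℝ) : ℂ) • vecMulVec w (star w), ?_, ?_, ?_, rfl, ?_⟩
  · positivity
  · exact (posSemidef_vecMulVec_self_star w).smul (by
      have : 0 ≤ N⁻¹ := by positivity
      exact_mod_cast this)
  · rw [Matrix.trace_smul, trace_vecMulVec, dotProduct_comm, hNc, smul_eq_mul,
      ← Complex.ofReal_mul, inv_mul_cancel₀ hN.ne', Complex.ofReal_one]
  · intro y
    rw [htr, htr]
    have hval : ∀ p q : ℝ, Real.sqrt (N⁻¹ * p * (N⁻¹ * q)) = Real.sqrt (p * q) / N := by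
      intro p q
      rw [show N⁻¹ * p * (N⁻¹ * q) = (p * q) / N ^ 2 by field_simp, Real.sqrt_div' _ (sq_nonneg N),
        Real.sqrt_sq hN.le]
    rw [hval]
    by_cases hy : y = 0
    · subst hy; simp
    have hny : 0 < ‖y‖ := norm_pos_iff.2 hy
    set c : ℝ := ‖y‖⁻¹ with hc
    have hcp : 0 < c := inv_pos.2 hny
    have hm := hmin (a := (c : ℂ) • y) (by
      rw [mem_sphere_zero_iff_norm, norm_smul, Complex.norm_real, Real.norm_of_nonneg hcp.le, hc,
        inv_mul_cancel₀ hny.ne'])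
    have hsc : ∀ L : Matrix (Fin n) (Fin n) ℂ, (star ((c : ℂ) • y) ⬝ᵥ L *ᵥ ((c : ℂ) • y)).re =
        c ^ 2 * (star y ⬝ᵥ L *ᵥ y).re := by
      intro L
      rw [star_smul, mulVec_smul, smul_dotProduct, dotProduct_smul, smul_smul, smul_eq_mul,
        RCLike.star_def, Complex.conj_ofReal, ← Complex.ofReal_mul, Complex.re_ofReal_mul, sq]
    have hsc1 := hsc 1
    rw [one_mulVec, one_mulVec] at hsc1
    simp only [Set.mem_ofPred_eq, hsc, hsc1] at hm
    have hyN := hposr y hy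
    rw [show ∀ p q : ℝ, c ^ 2 * p * (c ^ 2 * q) = (c ^ 2) ^ 2 * (p * q) by intros; ring,
      Real.sqrt_mul (sq_nonneg (c ^ 2)), Real.sqrt_sq (by positivity),
      le_div_iff₀ (by positivity)] at hm
    rw [← hNd] at hm
    have hc2 : 0 < c ^ 2 := by positivity
    refine le_of_mul_le_mul_left ?_ hc2
    calc _ = _ := ?_
      _ ≤ _ := hm
      _ = _ := ?_
    · ring
    · ring

/-- The polar of `F_min`: for positive definite `L₀, L₁`, the infimum of `tr(L₀X) + tr(L₁Y)`
over positive semidefinite `X, Y` admitting a Hermitian `C` with `[[X,C],[C,Y]] ≥ 0` and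
`Re(tr C) ≥ 1` equals the (attained) minimum over density matrices `ρ` of
`2√(tr(ρL₀)·tr(ρL₁))`. -/
theorem stmt_9 {n : ℕ} (hn : 0 < n) (L₀ L₁ : Matrix (Fin n) (Fin n) ℂ)
    (h0 : L₀.PosDef) (h1 : L₁.PosDef) :
    ∃ v : ℝ,
      IsLeast {t : ℝ | ∃ ρ : Matrix (Fin n) (Fin n) ℂ, ρ.PosSemidef ∧ ρ.trace = 1 ∧
          t = 2 * Real.sqrt (((ρ * L₀).trace).re * ((ρ * L₁).trace).re)} v ∧
      IsGLB {t : ℝ | ∃ X Y C : Matrix (Fin n) (Fin n) ℂ, X.PosSemidef ∧ Y.PosSemidef ∧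
          C.IsHermitian ∧ (Matrix.fromBlocks X C C Y).PosSemidef ∧ 1 ≤ (C.trace).re ∧
          t = ((L₀ * X).trace).re + ((L₁ * Y).trace).re} v := by
  obtain ⟨v, ρ₀, hv0, hρ₀, hρt, hvρ, hv⟩ := aux_exists hn L₀ L₁
  have hlow : v ∈ lowerBounds {t : ℝ | ∃ X Y C : Matrix (Fin n) (Fin n) ℂ, X.PosSemidef ∧
      Y.PosSemidef ∧ C.IsHermitian ∧ (Matrix.fromBlocks X C C Y).PosSemidef ∧
      1 ≤ (C.trace).re ∧ t = ((L₀ * X).trace).re + ((L₁ * Y).trace).re} := by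
    rintro t ⟨X, Y, C, hX, hY, hC, hb, ht, rfl⟩
    exact aux_main h0 h1 hv0 hv hY hC hb ht
  have hup : ∀ b ∈ lowerBounds {t : ℝ | ∃ X Y C : Matrix (Fin n) (Fin n) ℂ, X.PosSemidef ∧
      Y.PosSemidef ∧ C.IsHermitian ∧ (Matrix.fromBlocks X C C Y).PosSemidef ∧
      1 ≤ (C.trace).re ∧ t = ((L₀ * X).trace).re + ((L₁ * Y).trace).re},
      ∀ ρ : Matrix (Fin n) (Fin n) ℂ, ρ.PosSemidef → ρ.trace = 1 →
      b ≤ 2 * Real.sqrt (((ρ * L₀).trace).re * ((ρ * L₁).trace).re) := by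
    intro b hb ρ hρ hρt
    refine aux_real (aux_trace_nonneg hρ h0.posSemidef) (aux_trace_nonneg hρ h1.posSemidef) ?_
    intro a ha
    have ha' : 0 < a⁻¹ := inv_pos.2 ha
    refine hb ⟨(a : ℂ) • ρ, ((a⁻¹ : ℝ) : ℂ) • ρ, ρ, hρ.smul (by exact_mod_cast ha.le),
      hρ.smul (by exact_mod_cast ha'.le), hρ.isHermitian, aux_feas hρ ha, by simp [hρt], ?_⟩
    rw [Matrix.mul_smul, Matrix.mul_smul, Matrix.trace_smul, Matrix.trace_smul, smul_eq_mul,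
      smul_eq_mul, Complex.re_ofReal_mul, Complex.re_ofReal_mul, Matrix.trace_mul_comm L₀,
      Matrix.trace_mul_comm L₁]
  refine ⟨v, ⟨⟨ρ₀, hρ₀, hρt, hvρ⟩, ?_⟩, hlow, ?_⟩
  · rintro t ⟨ρ, hρ, hρt, rfl⟩
    exact hup v hlow ρ hρ hρt
  · intro b hb
    rw [hvρ]
    exact hup b hb ρ₀ hρ₀ hρt
end

section
/- Let F̂ be a family of functions assigning to each n ≥ 1 a map F̂_n from pairs of n×n complex matrices to ℝ. Suppose F̂ is monotone increasing under unital CP maps: for all n, m, every unital CP map Λ from n×n to m×m matrices (i.e. Λ(L) = Σ_i K_i L K_iᴴ for a finite family of m×n matrices K_i with Σ_i K_i K_iᴴ = 1), and all positive semidefinite n×n L₀, L₁, one has F̂_m(Λ(L₀), Λ(L₁)) ≥ F̂_n(L₀, L₁). Suppose further F̂ is polarly normalized: for every n and all vectors l₀, l₁ ∈ ℝ^n with nonnegative entries, F̂_n(diag l₀, diag l₁) = min_i 2√(l₀ᵢ · l₁ᵢ). Then for every n and all positive semidefinite n×n matrices L₀, L₁: (i) for every m ∈ ℕ, every POVM (M_i)_{i<m}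 on ℂⁿ, and all vectors l₀, l₁ ∈ ℝ^m with nonnegative entries satisfying L₀ = Σ_i l₀ᵢ M_i and L₁ = Σ_i l₁ᵢ M_i, one has min_i 2√(l₀ᵢ · l₁ᵢ) ≤ F̂_n(L₀, L₁); and (ii) for every n×n density matrix ρ, F̂_n(L₀, L₁) ≤ 2·√(tr(ρ·L₀) · tr(ρ·L₁)). -/
open Matrix ComplexOrder
open scoped Classical

open scoped MatrixOrder Matrix.Norms.L2Operator in
lemma psd_factor {n : ℕ} {A : Matrix (Fin n) (Fin n) ℂ} (hA : A.PosSemidef) :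
    ∃ B : Matrix (Fin n) (Fin n) ℂ, A = Bᴴ * B := by
  exact CStarAlgebra.nonneg_iff_eq_star_mul_self.mp hA.nonneg

lemma kraus_diag {n m : ℕ} (B : Fin m → Matrix (Fin n) (Fin n) ℂ) (l : Fin m → ℂ) :
    ∑ p : Fin m × Fin n,
      (Matrix.of (fun a b => if b = p.1 then star (B p.1 p.2 a) else 0) :
        Matrix (Fin n) (Fin m) ℂ) * Matrix.diagonal l *
      (Matrix.of (fun a b => if b = p.1 then star (B p.1 p.2 a) else 0) :
        Matrix (Fin n) (Fin m) ℂ)ᴴ = ∑ i, l i • ((B i)ᴴ * B i) := by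
  rw [Fintype.sum_prod_type]
  refine Finset.sum_congr rfl fun i _ => ?_
  ext a c
  rw [Matrix.sum_apply, Matrix.smul_apply, Matrix.mul_apply, smul_eq_mul, Finset.mul_sum]
  refine Finset.sum_congr rfl fun j _ => ?_
  rw [Matrix.mul_apply]
  simp only [Matrix.mul_diagonal, Matrix.of_apply, Matrix.conjTranspose_apply]
  rw [Finset.sum_eq_single i]
  · simp
    ring
  · intro b _ hb
    simp [hb]
  · simp

lemma kraus_trace {n : ℕ} (B L : Matrix (Fin n) (Fin n) ℂ) :
    ∑ j : Fin n, (Matrix.of (fun _ a => B j a) : Matrix (Fin 1) (Fin n) ℂ) * L *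
      (Matrix.of (fun _ a => B j a) : Matrix (Fin 1) (Fin n) ℂ)ᴴ
      = Matrix.diagonal (fun _ => (Bᴴ * B * L).trace) := by
  ext a c
  have : a = c := Subsingleton.elim _ _
  subst this
  rw [Matrix.diagonal_apply_eq, Matrix.mul_assoc, Matrix.trace_mul_comm, Matrix.trace,
    Matrix.sum_apply]
  refine Finset.sum_congr rfl fun j _ => ?_
  simp [Matrix.mul_apply]

lemma psd_trace {n : ℕ} (B L : Matrix (Fin n) (Fin n) ℂ) (hL : L.PosSemidef) :
    0 ≤ (Bᴴ * B * L).trace := by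
  have := (hL.mul_mul_conjTranspose_same B).trace_nonneg
  rwa [Matrix.mul_assoc, Matrix.trace_mul_comm]

/-- Any polarly-normalized two-matrix functional that is monotone increasing under unital
CP maps is sandwiched between the polars `F̂_max` (in its operational POVM form) and
`F̂_min` (in its operational density-matrix form). -/
theorem stmt_11
    (Fh : (n : ℕ) → Matrix (Fin n) (Fin n) ℂ → Matrix (Fin n) (Fin n) ℂ → ℝ)
    (hmono : ∀ (n m : ℕ), 1 ≤ n → 1 ≤ m →
      ∀ (k : ℕ) (K : Fin k → Matrix (Fin m) (Fin n) ℂ),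
        (∑ i, K i * (K i)ᴴ = 1) →
        ∀ L₀ L₁ : Matrix (Fin n) (Fin n) ℂ, L₀.PosSemidef → L₁.PosSemidef →
          Fh n L₀ L₁ ≤ Fh m (∑ i, K i * L₀ * (K i)ᴴ) (∑ i, K i * L₁ * (K i)ᴴ))
    (hnorm : ∀ (n : ℕ), 1 ≤ n → ∀ l₀ l₁ : Fin n → ℝ,
        (∀ i, 0 ≤ l₀ i) → (∀ i, 0 ≤ l₁ i) →
        Fh n (Matrix.diagonal (fun i => (l₀ i : ℂ))) (Matrix.diagonal (fun i => (l₁ i : ℂ)))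
          = ⨅ i, 2 * Real.sqrt (l₀ i * l₁ i)) :
    ∀ (n : ℕ), 1 ≤ n → ∀ L₀ L₁ : Matrix (Fin n) (Fin n) ℂ,
      L₀.PosSemidef → L₁.PosSemidef →
      (∀ (m : ℕ) (M : Fin m → Matrix (Fin n) (Fin n) ℂ) (l₀ l₁ : Fin m → ℝ),
          (∀ i, (M i).PosSemidef) → (∑ i, M i = 1) →
          (∀ i, 0 ≤ l₀ i) → (∀ i, 0 ≤ l₁ i) →
          (∑ i, (l₀ i : ℂ) • M i = L₀) → (∑ i, (l₁ i : ℂ) • M i = L₁) →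
          (⨅ i, 2 * Real.sqrt (l₀ i * l₁ i)) ≤ Fh n L₀ L₁) ∧
      (∀ ρ : Matrix (Fin n) (Fin n) ℂ, ρ.PosSemidef → ρ.trace = 1 →
          Fh n L₀ L₁ ≤ 2 * Real.sqrt (((ρ * L₀).trace).re * ((ρ * L₁).trace).re)) := by
  intro n hn L₀ L₁ h0 h1
  refine ⟨?_, ?_⟩
  · intro m M l₀ l₁ hM hsum hl0 hl1 e0 e1
    have hm : 1 ≤ m := by
      rcases Nat.eq_zero_or_pos m with h | h
      · subst h
        exfalso
        have := congrFun (congrFun hsum ⟨0, hn⟩) ⟨0, hn⟩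
        simp at this
      · exact h
    choose B hB using fun i => psd_factor (hM i)
    rw [← hnorm m hm l₀ l₁ hl0 hl1]
    let K : Fin m × Fin n → Matrix (Fin n) (Fin m) ℂ := fun p =>
      Matrix.of (fun a b => if b = p.1 then star (B p.1 p.2 a) else 0)
    have key : ∀ l : Fin m → ℂ, ∑ i, K (finProdFinEquiv.symm i) * Matrix.diagonal l *
        (K (finProdFinEquiv.symm i))ᴴ = ∑ i, l i • M i := by
      intro l
      rw [Equiv.sum_comp finProdFinEquiv.symm (fun p => K p * Matrix.diagonal l * (K p)ᴴ)]
      simp only [hB]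
      exact kraus_diag B l
    have h := hmono m n hm hn (m * n) (fun i => K (finProdFinEquiv.symm i))
      (by
        have := key 1
        simpa [hsum, Matrix.diagonal_one] using this)
      (Matrix.diagonal fun i => (l₀ i : ℂ)) (Matrix.diagonal fun i => (l₁ i : ℂ))
      (Matrix.PosSemidef.diagonal fun i => by simpa using hl0 i)
      (Matrix.PosSemidef.diagonal fun i => by simpa using hl1 i)
    rw [key, key, e0, e1] at h
    exact h
  · intro ρ hρ htr
    obtain ⟨B, rfl⟩ := psd_factor hρ
    have h := hmono n 1 hn le_rfl n (fun j => Matrix.of (fun _ a => B j a))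
      (by
        have := kraus_trace B 1
        rw [Matrix.mul_one, htr] at this
        simpa using this) L₀ L₁ h0 h1
    rw [kraus_trace, kraus_trace] at h
    have p0 := Complex.nonneg_iff.mp (psd_trace B L₀ h0)
    have p1 := Complex.nonneg_iff.mp (psd_trace B L₁ h1)
    have c0 : (Bᴴ * B * L₀).trace = (((Bᴴ * B * L₀).trace.re : ℝ) : ℂ) :=
      Complex.ext (by simp) (by simpa using p0.2.symm)
    have c1 : (Bᴴ * B * L₁).trace = (((Bᴴ * B * L₁).trace.re : ℝ) : ℂ) :=
      Complex.ext (by simp) (by simpa using p1.2.symm)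
    rw [c0, c1, hnorm 1 le_rfl (fun _ => (Bᴴ * B * L₀).trace.re)
      (fun _ => (Bᴴ * B * L₁).trace.re) (fun _ => p0.1) (fun _ => p1.1), ciInf_const] at h
    exact h
end

section
/- Let L₀ and L₁ be n×n positive definite matrices over ℂ, and define the ℂ-linear endomorphism T of the space of n×n complex matrices by T(X) := L₀·(L₁·X + X·L₁) + (L₁·X + X·L₁)·L₀. Then T is diagonalizable (its eigenvectors span the space of n×n matrices; equivalently T is a semisimple endomorphism), and every eigenvalue of T is a positive real number. -/
open Matrix ComplexOrder

theorem aux_abs {V : Type*} [AddCommGroup V] [Module ℂ V] [FiniteDimensional ℂ V]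
    (c : InnerProductSpace.Core ℂ V) (T : Module.End ℂ V)
    (hs : ∀ x y, c.inner (T x) y = c.inner x (T y))
    (hp : ∀ x, x ≠ 0 → 0 < (c.inner x (T x)).re) :
    (⨆ μ : ℂ, Module.End.eigenspace T μ) = ⊤ ∧
    (∀ μ : ℂ, Module.End.HasEigenvalue T μ → ∃ r : ℝ, 0 < r ∧ μ = (r : ℂ)) := by
  letI : NormedAddCommGroup V := c.toNormedAddCommGroup
  letI : InnerProductSpace ℂ V := InnerProductSpace.ofCore c.toCore
  have hsym : LinearMap.IsSymmetric T := fun x y => hs x y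
  refine ⟨?_, ?_⟩
  · have h := hsym.orthogonalComplement_iSup_eigenspaces_eq_bot
    exact (Submodule.orthogonal_eq_bot_iff).1 h
  · intro μ hμ
    have hc := hsym.conj_eigenvalue_eq_self hμ
    obtain ⟨x, hx⟩ := hμ.exists_hasEigenvector
    have hre : μ = (μ.re : ℂ) := (Complex.conj_eq_iff_re.1 hc).symm
    refine ⟨μ.re, ?_, hre⟩
    have h1 : 0 < (inner ℂ x (T x)).re := hp x hx.2
    rw [hx.apply_eq_smul, inner_smul_right, inner_self_eq_norm_sq_to_K, hre] at h1
    have h2 : 0 < μ.re * ‖x‖ ^ 2 := by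
      have : ((μ.re : ℂ) * ((‖x‖ : ℂ)) ^ 2).re = μ.re * ‖x‖ ^ 2 := by
        norm_cast
      rw [← this]; exact h1
    exact pos_of_mul_pos_left h2 (by positivity)

theorem aux_pos {n : ℕ} (L X : Matrix (Fin n) (Fin n) ℂ) (h : L.PosDef) (hX : X ≠ 0) :
    0 < (Xᴴ * (L * X + X * L)).trace := by
  have e : (Xᴴ * (L * X + X * L)).trace = (Xᴴ * L * X).trace + (X * L * Xᴴ).trace := by
    rw [Matrix.mul_add, Matrix.trace_add, ← Matrix.mul_assoc, Matrix.trace_mul_comm Xᴴ (X * L)]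
  have a := h.posSemidef.conjTranspose_mul_mul_same X
  have b := (h.posSemidef.mul_mul_conjTranspose_same X).trace_nonneg
  have a0 : (Xᴴ * L * X).trace ≠ 0 := by
    intro h0
    rw [a.trace_eq_zero_iff] at h0
    apply hX
    apply Matrix.ext_of_mulVec_single
    intro i
    rw [Matrix.zero_mulVec]
    by_contra hv
    have := h.dotProduct_mulVec_pos hv
    rw [Matrix.star_mulVec, ← Matrix.dotProduct_mulVec, Matrix.mulVec_mulVec,
      Matrix.mulVec_mulVec, h0] at this
    simp at this
  rw [e]
  exact add_pos_of_pos_of_nonneg (lt_of_le_of_ne a.trace_nonneg a0.symm) b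

theorem aux_sym {n : ℕ} (L X Y : Matrix (Fin n) (Fin n) ℂ) (h : L.IsHermitian) :
    ((L * X + X * L)ᴴ * Y).trace = (Xᴴ * (L * Y + Y * L)).trace := by
  rw [conjTranspose_add, conjTranspose_mul, conjTranspose_mul, h.eq, Matrix.add_mul,
    Matrix.mul_add, trace_add, trace_add, Matrix.mul_assoc, Matrix.mul_assoc L,
    trace_mul_comm L, Matrix.mul_assoc]

/-- The inner product `tr(Xᴴ (L Y + Y L))`. -/
@[reducible] noncomputable def auxCore {n : ℕ} (L : Matrix (Fin n) (Fin n) ℂ) (h : L.PosDef) :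
    InnerProductSpace.Core ℂ (Matrix (Fin n) (Fin n) ℂ) where
  inner X Y := (Xᴴ * (L * Y + Y * L)).trace
  conj_inner_symm X Y := by
    change star _ = _
    rw [← trace_conjTranspose, conjTranspose_mul, conjTranspose_conjTranspose,
      aux_sym L X Y h.isHermitian]
  re_inner_nonneg X := by
    by_cases hX : X = 0
    · simp [hX]
    · exact (Complex.le_def.1 (aux_pos L X h hX).le).1
  add_left X Y Z := by
    rw [conjTranspose_add, Matrix.add_mul, trace_add]
  smul_left X Y r := by
    simp
  definite X hX := by
    by_contra h0
    exact (aux_pos L X h h0).ne' hX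

/-- The map `T(X) = L₀{L₁,X} + {L₁,X}L₀` (the inverse of `S_{L₁}∘S_{L₀}`) is
diagonalizable — its eigenspaces span the whole matrix space — and all its
eigenvalues are positive reals. -/
theorem stmt_13 {n : ℕ} (L₀ L₁ : Matrix (Fin n) (Fin n) ℂ)
    (h0 : L₀.PosDef) (h1 : L₁.PosDef)
    (T : Module.End ℂ (Matrix (Fin n) (Fin n) ℂ))
    (hT : ∀ X, T X = L₀ * (L₁ * X + X * L₁) + (L₁ * X + X * L₁) * L₀) :
    (⨆ μ : ℂ, Module.End.eigenspace T μ) = ⊤ ∧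
    (∀ μ : ℂ, Module.End.HasEigenvalue T μ → ∃ r : ℝ, 0 < r ∧ μ = (r : ℂ)) := by
  apply aux_abs (auxCore L₁ h1) T
  · intro X Y
    change ((T X)ᴴ * (L₁ * Y + Y * L₁)).trace = (Xᴴ * (L₁ * T Y + T Y * L₁)).trace
    rw [← aux_sym L₁ X (T Y) h1.isHermitian, hT, hT, aux_sym L₀ _ _ h0.isHermitian]
  · intro X hX
    change 0 < ((Xᴴ * (L₁ * T X + T X * L₁)).trace).re
    rw [← aux_sym L₁ X (T X) h1.isHermitian, hT]
    have hne : L₁ * X + X * L₁ ≠ 0 := by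
      intro h
      have := aux_pos L₁ X h1 hX
      rw [h] at this
      simp at this
    exact (Complex.lt_def.1 (aux_pos L₀ _ h0 hne)).1
end

section
/- Let L₀ and L₁ be n×n positive definite matrices over ℂ, and define the ℂ-linear endomorphism T of the space of n×n complex matrices by T(X) := L₁·(L₀·X + X·L₀) + (L₀·X + X·L₀)·L₁. Suppose A is a positive definite n×n matrix with T(A) = β·A for some β ∈ ℝ, and A' is a nonzero Hermitian n×n matrix with T(A') = β'·A' for some β' ∈ ℝ. Then β ≤ β'. -/
open Matrix ComplexOrder

lemma quad_real {n : ℕ} {H : Matrix (Fin n) (Fin n) ℂ} (hH : H.IsHermitian) (x : Fin n → ℂ) :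
    ((star x ⬝ᵥ (H *ᵥ x)).re : ℂ) = star x ⬝ᵥ (H *ᵥ x) := by
  apply Complex.conj_eq_iff_re.mp
  change star (star x ⬝ᵥ (H *ᵥ x)) = _
  have e : star (star x ⬝ᵥ (H *ᵥ x)) = star (H *ᵥ x) ⬝ᵥ x := by
    rw [Matrix.star_dotProduct, star_star]
  rw [e, star_mulVec, hH.eq, dotProduct_mulVec]

lemma psd_of_re {n : ℕ} {H : Matrix (Fin n) (Fin n) ℂ} (hH : H.IsHermitian)
    (h : ∀ x, 0 ≤ (star x ⬝ᵥ (H *ᵥ x)).re) : H.PosSemidef := by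
  refine PosSemidef.of_dotProduct_mulVec_nonneg hH fun x => ?_
  rw [← quad_real hH x]
  exact_mod_cast h x

lemma herm_real_smul {n : ℕ} {H : Matrix (Fin n) (Fin n) ℂ} (hH : H.IsHermitian) (r : ℝ) :
    ((r : ℂ) • H).IsHermitian := by
  unfold IsHermitian
  rw [conjTranspose_smul, hH.eq]
  simp

lemma quad_smul {n : ℕ} (H : Matrix (Fin n) (Fin n) ℂ) (r : ℝ) (x : Fin n → ℂ) :
    (star x ⬝ᵥ ((r : ℂ) • H) *ᵥ x).re = r * (star x ⬝ᵥ (H *ᵥ x)).re := by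
  rw [smul_mulVec, dotProduct_smul]
  simp

lemma quad_sub {n : ℕ} (G H : Matrix (Fin n) (Fin n) ℂ) (x : Fin n → ℂ) :
    (star x ⬝ᵥ (G - H) *ᵥ x).re = (star x ⬝ᵥ (G *ᵥ x)).re - (star x ⬝ᵥ (H *ᵥ x)).re := by
  rw [sub_mulVec, dotProduct_sub, Complex.sub_re]

lemma exists_max {n : ℕ} [NeZero n] {A H : Matrix (Fin n) (Fin n) ℂ} (hA : A.PosDef)
    (hH : H.IsHermitian) : ∃ (m : ℝ) (v : Fin n → ℂ), v ≠ 0 ∧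
      ((m : ℂ) • A - H).PosSemidef ∧
      (star v ⬝ᵥ (H *ᵥ v)).re = m * (star v ⬝ᵥ (A *ᵥ v)).re := by
  have hpos : ∀ x : Fin n → ℂ, x ≠ 0 → 0 < (star x ⬝ᵥ (A *ᵥ x)).re := fun x hx =>
    hA.re_dotProduct_pos hx
  have hcont : ∀ B : Matrix (Fin n) (Fin n) ℂ,
      Continuous fun x : Fin n → ℂ => (star x ⬝ᵥ (B *ᵥ x)).re := by
    intro B
    refine Complex.continuous_re.comp ?_
    exact Continuous.dotProduct continuous_star (Continuous.matrix_mulVec continuous_const continuous_id)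
  have hne : ∀ x ∈ Metric.sphere (0 : Fin n → ℂ) 1, x ≠ 0 := by
    rintro x hx rfl
    simp at hx
  obtain ⟨v, hv, hmax⟩ := (isCompact_sphere (0 : Fin n → ℂ) 1).exists_isMaxOn
    (NormedSpace.sphere_nonempty.mpr zero_le_one)
    (f := fun x => (star x ⬝ᵥ (H *ᵥ x)).re / (star x ⬝ᵥ (A *ᵥ x)).re)
    ((hcont H).continuousOn.div (hcont A).continuousOn fun x hx => (hpos x (hne x hx)).ne')
  refine ⟨_, v, hne v hv, psd_of_re ((herm_real_smul hA.1 _).sub hH) ?_,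
    (div_mul_cancel₀ _ (hpos v (hne v hv)).ne').symm⟩
  intro x
  rw [quad_sub, quad_smul]
  by_cases hx : x = 0
  · simp [hx]
  set y : Fin n → ℂ := ((‖x‖⁻¹ : ℝ) : ℂ) • x with hy
  have hnx : 0 < ‖x‖ := norm_pos_iff.mpr hx
  have hys : y ∈ Metric.sphere (0 : Fin n → ℂ) 1 := by
    simp [hy, norm_smul, hnx.ne']
  have hq : ∀ B : Matrix (Fin n) (Fin n) ℂ, (star y ⬝ᵥ (B *ᵥ y)).re
      = (‖x‖⁻¹ ^ 2) * (star x ⬝ᵥ (B *ᵥ x)).re := by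
    intro B
    rw [hy, star_smul, mulVec_smul, dotProduct_smul, smul_dotProduct]
    simp only [smul_eq_mul, RCLike.star_def, Complex.conj_ofReal, Complex.re_ofReal_mul]
    ring
  have h1 := hmax hys
  simp only [Set.mem_ofPred_eq] at h1
  rw [hq H, hq A, mul_div_mul_left _ _ (by positivity), div_le_iff₀ (hpos x hx)] at h1
  linarith

lemma lyap {n : ℕ} {Z W : Matrix (Fin n) (Fin n) ℂ} (hZ : Z.PosDef) (hW : W.IsHermitian)
    (h : (Z * W + W * Z).PosSemidef) : W.PosSemidef := by
  rw [hW.posSemidef_iff_eigenvalues_nonneg]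
  intro i
  set v : Fin n → ℂ := (hW.eigenvectorBasis i).ofLp with hv
  have he : W *ᵥ v = (hW.eigenvalues i : ℂ) • v := by
    rw [hv, hW.mulVec_eigenvectorBasis i]; rfl
  have he' : star v ᵥ* W = (hW.eigenvalues i : ℂ) • star v := by
    have := congrArg star he
    rw [star_mulVec, hW.eq, star_smul] at this
    simpa using this
  have hv0 : v ≠ 0 := by
    intro h0
    exact hW.eigenvectorBasis.orthonormal.ne_zero i (by ext j; exact congrFun h0 j)
  have h1 := h.re_dotProduct_nonneg v
  have h2 := hZ.re_dotProduct_pos hv0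
  have h3 : star v ⬝ᵥ ((Z * W + W * Z) *ᵥ v)
      = ((2 * hW.eigenvalues i : ℝ) : ℂ) * (star v ⬝ᵥ (Z *ᵥ v)) := by
    rw [add_mulVec, dotProduct_add, ← mulVec_mulVec, ← mulVec_mulVec, he, dotProduct_mulVec (star v) W,
      he', mulVec_smul, dotProduct_smul, smul_dotProduct]
    simp only [smul_eq_mul]
    push_cast
    ring
  rw [h3] at h1
  simp only [RCLike.re_eq_complex_re, Complex.re_ofReal_mul] at h1 h2
  by_contra hneg
  rw [Pi.zero_apply] at hneg
  nlinarith

lemma herm_anti {n : ℕ} {Z W : Matrix (Fin n) (Fin n) ℂ} (hZ : Z.IsHermitian)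
    (hW : W.IsHermitian) : (Z * W + W * Z).IsHermitian := by
  unfold IsHermitian
  rw [conjTranspose_add, conjTranspose_mul, conjTranspose_mul, hZ.eq, hW.eq, add_comm]

lemma psd_antisymm {n : ℕ} {W : Matrix (Fin n) (Fin n) ℂ} (h : W.PosSemidef)
    (h' : (-W).PosSemidef) : W = 0 := by
  have a := h.trace_nonneg
  have b := h'.trace_nonneg
  rw [trace_neg] at b
  exact h.trace_eq_zero_iff.mp (le_antisymm (neg_nonneg.mp b) a)

lemma lyap_zero {n : ℕ} {Z W : Matrix (Fin n) (Fin n) ℂ} (hZ : Z.PosDef) (hW : W.IsHermitian)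
    (h : Z * W + W * Z = 0) : W = 0 := by
  refine psd_antisymm (lyap hZ hW ?_) (lyap hZ hW.neg ?_)
  · rw [h]; exact PosSemidef.zero
  · rw [mul_neg, neg_mul, ← neg_add, h, neg_zero]; exact PosSemidef.zero

lemma sandwich {n : ℕ} {Z W : Matrix (Fin n) (Fin n) ℂ} (hZ : Z.PosDef) (hW : W.IsHermitian) :
    (W * Z * W).PosSemidef := by
  have := hZ.posSemidef.conjTranspose_mul_mul_same W
  rwa [hW.eq] at this

lemma sandwich_zero {n : ℕ} {Z W : Matrix (Fin n) (Fin n) ℂ} (hZ : Z.PosDef) (hW : W.IsHermitian)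
    (h : W * Z * W = 0) : W = 0 := by
  by_contra hne
  have : ∃ x, W *ᵥ x ≠ 0 := by
    by_contra hall
    push Not at hall
    exact hne (Matrix.ext_of_mulVec_single fun i => by rw [hall, zero_mulVec])
  obtain ⟨x, hx⟩ := this
  have h2 := hZ.dotProduct_mulVec_pos hx
  rw [star_mulVec, hW.eq, ← dotProduct_mulVec, mulVec_mulVec, mulVec_mulVec, h] at h2
  simp at h2

lemma eig_pos {n : ℕ} {L₀ L₁ B : Matrix (Fin n) (Fin n) ℂ} (h0 : L₀.PosDef) (h1 : L₁.PosDef)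
    (hB : B.IsHermitian) (hB0 : B ≠ 0) (b : ℝ)
    (h : L₁ * (L₀ * B + B * L₀) + (L₀ * B + B * L₀) * L₁ = (b : ℂ) • B) : 0 < b := by
  set Y := L₀ * B + B * L₀ with hY
  have hYh : Y.IsHermitian := herm_anti h0.1 hB
  have hY0 : Y ≠ 0 := fun h => hB0 (lyap_zero h0 hB h)
  have t1 := (sandwich h1 hYh).trace_nonneg
  have t1' : (Y * L₁ * Y).trace ≠ 0 := fun h =>
    hY0 (sandwich_zero h1 hYh ((sandwich h1 hYh).trace_eq_zero_iff.mp h))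
  have t2 := (sandwich h0 hB).trace_nonneg
  have e := congrArg (fun M => (Y * M).trace) h
  simp only [mul_add, Matrix.mul_smul, trace_add, trace_smul, smul_eq_mul] at e
  have e1 : (Y * (Y * L₁)).trace = (Y * L₁ * Y).trace := by
    rw [trace_mul_comm]
  have e2 : (Y * B).trace = 2 * (B * L₀ * B).trace := by
    rw [hY, add_mul, trace_add, mul_assoc L₀ B B, trace_mul_comm L₀, mul_assoc B B L₀,
      trace_mul_comm B (B * L₀)]
    ring
  rw [e1, e2, ← mul_assoc] at e
  have r1 : 0 < (Y * L₁ * Y).trace := lt_of_le_of_ne t1 t1'.symm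
  rw [Complex.lt_def] at r1
  rw [Complex.le_def] at t2
  have e3 := congrArg Complex.re e
  simp only [Complex.add_re, Complex.re_ofReal_mul] at e3
  have e4 : (2 * (B * L₀ * B).trace).re = 2 * (B * L₀ * B).trace.re := by simp
  rw [e4] at e3
  have r1' := r1.1
  have t2' := t2.1
  simp only [Complex.zero_re] at r1' t2'
  by_contra hb
  nlinarith

lemma core {n : ℕ} (L₀ L₁ : Matrix (Fin n) (Fin n) ℂ)
    (h0 : L₀.PosDef) (h1 : L₁.PosDef)
    (T : Module.End ℂ (Matrix (Fin n) (Fin n) ℂ))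
    (hT : ∀ X, T X = L₁ * (L₀ * X + X * L₀) + (L₀ * X + X * L₀) * L₁)
    (A A' : Matrix (Fin n) (Fin n) ℂ) (β β' : ℝ)
    (hA : A.PosDef) (hβ : T A = (β : ℂ) • A)
    (hA' : A'.IsHermitian) (hβ' : T A' = (β' : ℂ) • A') (p : 0 < β) (p' : 0 < β')
    (m : ℝ) (hm : 0 < m) (v : Fin n → ℂ) (hv : v ≠ 0)
    (hP : ((m : ℂ) • A - A').PosSemidef)
    (he : (star v ⬝ᵥ (A' *ᵥ v)).re = m * (star v ⬝ᵥ (A *ᵥ v)).re) : β ≤ β' := by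
  have hc : (β : ℂ) ≠ 0 := by exact_mod_cast p.ne'
  have hc' : (β' : ℂ) ≠ 0 := by exact_mod_cast p'.ne'
  have hY : (((m / β : ℝ) : ℂ) • A - ((1 / β' : ℝ) : ℂ) • A').IsHermitian :=
    (herm_real_smul hA.1 _).sub (herm_real_smul hA' _)
  have hTY : T (((m / β : ℝ) : ℂ) • A - ((1 / β' : ℝ) : ℂ) • A') = (m : ℂ) • A - A' := by
    rw [map_sub, map_smul, map_smul, hβ, hβ', smul_smul, smul_smul]
    push_cast
    rw [div_mul_cancel₀ _ hc, div_mul_cancel₀ _ hc', one_smul]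
  rw [← hTY, hT] at hP
  have hp := lyap h0 hY (lyap h1 (herm_anti h0.1 hY) hP)
  have h3 := hp.re_dotProduct_nonneg v
  have h4 := hA.re_dotProduct_pos hv
  simp only [RCLike.re_eq_complex_re] at h3 h4
  rw [quad_sub, quad_smul, quad_smul, he] at h3
  have h5 : 0 ≤ (m * (star v ⬝ᵥ (A *ᵥ v)).re) * (1 / β - 1 / β') := by
    convert h3 using 1; ring
  have h6 := nonneg_of_mul_nonneg_right h5 (mul_pos hm h4)
  exact (one_div_le_one_div p' p).mp (sub_nonneg.mp h6)

theorem stmt_14 {n : ℕ} (L₀ L₁ : Matrix (Fin n) (Fin n) ℂ)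
    (h0 : L₀.PosDef) (h1 : L₁.PosDef)
    (T : Module.End ℂ (Matrix (Fin n) (Fin n) ℂ))
    (hT : ∀ X, T X = L₁ * (L₀ * X + X * L₀) + (L₀ * X + X * L₀) * L₁)
    (A A' : Matrix (Fin n) (Fin n) ℂ) (β β' : ℝ)
    (hA : A.PosDef) (hβ : T A = (β : ℂ) • A)
    (hA' : A'.IsHermitian) (hA'0 : A' ≠ 0) (hβ' : T A' = (β' : ℂ) • A') :
    β ≤ β' := by
  have hn : NeZero n := ⟨by
    rintro rfl
    exact hA'0 (Subsingleton.elim _ _)⟩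
  have hA0 : A ≠ 0 := by
    rintro rfl
    have := hA.diag_pos (i := (0 : Fin n))
    simp at this
  have p : 0 < β := eig_pos h0 h1 hA.1 hA0 β (by rw [← hT, hβ])
  have p' : 0 < β' := eig_pos h0 h1 hA' hA'0 β' (by rw [← hT, hβ'])
  have aux : ∀ (m : ℝ) (B : Matrix (Fin n) (Fin n) ℂ), m ≤ 0 →
      ((m : ℂ) • A - B).PosSemidef → (-B).PosSemidef := by
    intro m B hm h
    have h2 : (((-m : ℝ) : ℂ) • A).PosSemidef :=
      hA.posSemidef.smul (by exact_mod_cast neg_nonneg.mpr hm)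
    have := h.add h2
    convert this using 1
    push_cast
    rw [neg_smul]
    abel
  obtain ⟨m, v, hv, hP, he⟩ := exists_max hA hA'
  obtain ⟨m', v', hv', hP', he'⟩ := exists_max hA hA'.neg
  rcases lt_or_ge 0 m with hm | hm
  · exact core L₀ L₁ h0 h1 T hT A A' β β' hA hβ hA' hβ' p p' m hm v hv hP he
  rcases lt_or_ge 0 m' with hm' | hm'
  · exact core L₀ L₁ h0 h1 T hT A (-A') β β' hA hβ hA'.neg (by rw [map_neg, hβ', smul_neg])
      p p' m' hm' v' hv' hP' he'
  · have a := aux m _ hm hP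
    have b := aux m' _ hm' hP'
    rw [neg_neg] at b
    exact absurd (psd_antisymm b a) hA'0
end

section
/- Let L₀ and L₁ be n×n positive definite matrices over ℂ, and define the ℂ-linear endomorphism T of the space of n×n complex matrices by T(X) := L₁·(L₀·X + X·L₀) + (L₀·X + X·L₀)·L₁. Suppose A is a nonzero positive semidefinite n×n matrix with T(A) = β·A for some β ∈ ℝ. Then the range of A (the support of A) is an invariant subspace of both L₀ and L₁; that is, L₀ maps the range of A into the range of A, and likewise L₁. -/
open Matrix ComplexOrder

lemma quad_aux {n : ℕ} {B : Matrix (Fin n) (Fin n) ℂ} (hB : B.IsHermitian)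
    (u w : Fin n → ℂ) : star u ⬝ᵥ (B *ᵥ w) = star (B *ᵥ u) ⬝ᵥ w := by
  rw [star_mulVec, hB.eq, dotProduct_mulVec]

lemma lyap_aux {n : ℕ} {L B : Matrix (Fin n) (Fin n) ℂ} (hL : L.PosDef)
    (hB : B.IsHermitian) (hP : (L * B + B * L).PosSemidef) : B.PosSemidef := by
  rw [hB.posSemidef_iff_eigenvalues_nonneg]
  intro i
  by_contra hneg
  simp only [Pi.zero_apply, not_le] at hneg
  have hv0 : (⇑(hB.eigenvectorBasis i) : Fin n → ℂ) ≠ 0 := by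
    intro h
    apply hB.eigenvectorBasis.orthonormal.ne_zero i
    ext j
    exact congrFun h j
  have hev := hB.mulVec_eigenvectorBasis i
  generalize (⇑(hB.eigenvectorBasis i) : Fin n → ℂ) = v at hv0 hev
  generalize hB.eigenvalues i = c at hneg hev
  have h1 := hP.dotProduct_mulVec_nonneg v
  have h2 := hL.dotProduct_mulVec_pos hv0
  rw [add_mulVec, ← mulVec_mulVec, ← mulVec_mulVec, dotProduct_add, quad_aux hB, hev,
    mulVec_smul, dotProduct_smul, star_smul, smul_dotProduct] at h1
  have h1' := (Complex.le_def.1 h1).1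
  have h2' := (Complex.lt_def.1 h2).1
  simp at h1' h2'
  nlinarith

lemma ker_aux {n : ℕ} {L B P : Matrix (Fin n) (Fin n) ℂ} (hB : B.IsHermitian)
    (hP : P.PosSemidef) (h : L * B + B * L = P) (v : Fin n → ℂ) (hv : B *ᵥ v = 0) :
    P *ᵥ v = 0 ∧ B *ᵥ (L *ᵥ v) = 0 := by
  have e : P *ᵥ v = B *ᵥ (L *ᵥ v) := by
    rw [← h, add_mulVec, ← mulVec_mulVec, ← mulVec_mulVec, hv, mulVec_zero, zero_add]
  have h0 : P *ᵥ v = 0 := by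
    rw [← hP.dotProduct_mulVec_zero_iff, e, quad_aux hB, hv]
    simp
  exact ⟨h0, e ▸ h0⟩

lemma lyap_herm {n : ℕ} {L B : Matrix (Fin n) (Fin n) ℂ} (hL : L.IsHermitian)
    (hB : B.IsHermitian) : (L * B + B * L).IsHermitian := by
  unfold Matrix.IsHermitian
  rw [conjTranspose_add, conjTranspose_mul, conjTranspose_mul, hL.eq, hB.eq, add_comm]

lemma range_aux {n : ℕ} {L A : Matrix (Fin n) (Fin n) ℂ} (hL : L.IsHermitian)
    (hA : A.IsHermitian) (h : ∀ v, A *ᵥ v = 0 → A *ᵥ (L *ᵥ v) = 0) (v : Fin n → ℂ)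
    (hv : v ∈ LinearMap.range A.mulVecLin) : L *ᵥ v ∈ LinearMap.range A.mulVecLin := by
  obtain ⟨w, rfl⟩ := hv
  let f := A.mulVecLin
  let g := (A * L).mulVecLin
  have hk : LinearMap.ker f ≤ LinearMap.ker g := by
    intro x hx
    simp only [f, g, LinearMap.mem_ker, mulVecLin_apply] at hx ⊢
    rw [← mulVec_mulVec]
    exact h x hx
  obtain ⟨m, hm⟩ := LinearMap.exists_extend
    (((LinearMap.ker f).liftQ g hk).comp f.quotKerEquivRange.symm.toLinearMap)
  have hm' : ∀ x, m (A *ᵥ x) = (A * L) *ᵥ x := by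
    intro x
    have := LinearMap.congr_fun hm ⟨f x, LinearMap.mem_range_self f x⟩
    rw [LinearMap.comp_apply, LinearMap.comp_apply, LinearEquiv.coe_coe,
      LinearMap.quotKerEquivRange_symm_apply_image] at this
    exact this
  have hM : LinearMap.toMatrix' m * A = A * L := by
    apply Matrix.toLin'.injective
    refine LinearMap.ext fun x => ?_
    rw [toLin'_apply, toLin'_apply, ← mulVec_mulVec, LinearMap.toMatrix'_mulVec, hm']
  have hM' := congrArg conjTranspose hM
  rw [conjTranspose_mul, conjTranspose_mul, hA.eq, hL.eq] at hM'
  refine ⟨(LinearMap.toMatrix' m)ᴴ *ᵥ w, ?_⟩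
  simp only [mulVecLin_apply, mulVec_mulVec, hM']

/-- For `T(X) = L₁{L₀,X} + {L₀,X}L₁` with `L₀, L₁` positive definite: the range (support)
of any nonzero positive semidefinite eigenvector `A` of `T` is an invariant subspace of
both `L₀` and `L₁`. -/
theorem stmt_15 {n : ℕ} (L₀ L₁ : Matrix (Fin n) (Fin n) ℂ)
    (h0 : L₀.PosDef) (h1 : L₁.PosDef)
    (T : Module.End ℂ (Matrix (Fin n) (Fin n) ℂ))
    (hT : ∀ X, T X = L₁ * (L₀ * X + X * L₀) + (L₀ * X + X * L₀) * L₁)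
    (A : Matrix (Fin n) (Fin n) ℂ) (β : ℝ)
    (hA : A.PosSemidef) (hA0 : A ≠ 0) (hβ : T A = (β : ℂ) • A) :
    ∀ v, v ∈ LinearMap.range A.mulVecLin →
      L₀.mulVec v ∈ LinearMap.range A.mulVecLin ∧
      L₁.mulVec v ∈ LinearMap.range A.mulVecLin := by
  rw [hT] at hβ
  have hBh := lyap_herm h0.1 hA.1
  have hpos : 0 < β := by
    by_contra hb
    have hb' : (0 : ℂ) ≤ ((-β : ℝ) : ℂ) := by exact_mod_cast (by linarith : (0:ℝ) ≤ -β)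
    have hBn : (-(L₀ * A + A * L₀)).PosSemidef := by
      apply lyap_aux h1 hBh.neg
      have : L₁ * -(L₀ * A + A * L₀) + -(L₀ * A + A * L₀) * L₁ = ((-β : ℝ) : ℂ) • A := by
        rw [mul_neg, neg_mul, ← neg_add, hβ]
        simp
      rw [this]
      exact hA.smul hb'
    have hAn : (-A).PosSemidef := by
      apply lyap_aux h0 hA.1.neg
      rwa [mul_neg, neg_mul, ← neg_add]
    apply hA0
    have hz : ∀ v, A *ᵥ v = 0 := by
      intro v
      rw [← hA.dotProduct_mulVec_zero_iff]
      apply le_antisymm _ (hA.dotProduct_mulVec_nonneg v)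
      have := hAn.dotProduct_mulVec_nonneg v
      rwa [neg_mulVec, dotProduct_neg, neg_nonneg] at this
    apply Matrix.toLin'.injective
    ext1 x
    ext1
    simp [hz]
  have hb : (0 : ℂ) ≤ (β : ℂ) := by exact_mod_cast hpos.le
  have hP := hA.smul hb
  have hB : (L₀ * A + A * L₀).PosSemidef := lyap_aux h1 hBh (by rw [hβ]; exact hP)
  intro v hv
  refine ⟨range_aux h0.1 hA.1 (fun k hk => (ker_aux hA.1 hB rfl k hk).2) v hv,
    range_aux h1.1 hA.1 (fun k hk => ?_) v hv⟩
  have k1 := (ker_aux hA.1 hB rfl k hk).1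
  have k2 := (ker_aux hBh hP hβ k k1).2
  have k3 := (ker_aux hBh hP hβ _ k2).1
  rw [smul_mulVec, smul_eq_zero] at k3
  rcases k3 with k3 | k3
  · exact absurd (by exact_mod_cast k3) hpos.ne'
  · exact k3
end

section
/- Let L₀, L₁, L₀', L₁' be 2×2 positive semidefinite matrices over ℂ with tr L₀ = tr L₁ = tr L₀' = tr L₁' = 2 and tr(L₀²) = tr(L₁²) = tr(L₀'²) = tr(L₁'²). Then there exists a unital CP map Λ from 2×2 to 2×2 matrices with Λ(L₀) = L₀' and Λ(L₁) = L₁' if and only if tr(L₀·L₁) = tr(L₀'·L₁'). -/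
open Matrix ComplexOrder

lemma aux_spec (A B : Matrix (Fin 2) (Fin 2) ℂ) (hA : A.IsHermitian) (hB : B.IsHermitian)
    (ht : A.trace = B.trace) (hp : (A * A).trace = (B * B).trace) :
    hA.eigenvalues = hB.eigenvalues := by
  rw [Matrix.IsHermitian.eigenvalues_eq_eigenvalues_iff, Matrix.charpoly_fin_two, Matrix.charpoly_fin_two, ht]
  have : A.det = B.det := by
    simp only [Matrix.det_fin_two, Matrix.trace_fin_two, Matrix.mul_apply, Fin.sum_univ_two] at *
    linear_combination (1/2 : ℂ) * (A 0 0 + A 1 1 + B 0 0 + B 1 1) * ht - (1/2 : ℂ) * hp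
  rw [this]

lemma aux_diag (A : Matrix (Fin 2) (Fin 2) ℂ) (hA : A.IsHermitian) :
    ∃ V : Matrix (Fin 2) (Fin 2) ℂ, V * Vᴴ = 1 ∧ Vᴴ * V = 1 ∧
      A = V * diagonal (fun i => (hA.eigenvalues i : ℂ)) * Vᴴ := by
  refine ⟨hA.eigenvectorUnitary, ?_, ?_, ?_⟩
  · exact Unitary.mul_star_self_of_mem hA.eigenvectorUnitary.2
  · exact Unitary.star_mul_self_of_mem hA.eigenvectorUnitary.2
  · exact hA.spectral_theorem

lemma aux_phase (d : Fin 2 → ℂ) (hd : d 0 ≠ d 1) (M M' : Matrix (Fin 2) (Fin 2) ℂ)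
    (hM : M.IsHermitian) (hM' : M'.IsHermitian)
    (ht : M.trace = M'.trace) (hp : (M * M).trace = (M' * M').trace)
    (ho : (diagonal d * M).trace = (diagonal d * M').trace) :
    ∃ W : Matrix (Fin 2) (Fin 2) ℂ, W * Wᴴ = 1 ∧ W * diagonal d * Wᴴ = diagonal d ∧
      W * M * Wᴴ = M' := by
  have e1 := hM.apply 1 0
  have e2 := hM'.apply 1 0
  simp only [Matrix.trace_fin_two, Matrix.mul_apply, Fin.sum_univ_two, diagonal_apply] at *
  simp at ho
  have a0 : M 0 0 = M' 0 0 := by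
    apply mul_left_cancel₀ (sub_ne_zero.2 hd)
    linear_combination ho - d 1 * ht
  have a1 : M 1 1 = M' 1 1 := by linear_combination ht - a0
  have hb : M 0 1 * star (M 0 1) = M' 0 1 * star (M' 0 1) := by
    rw [a0, a1, ← e1, ← e2] at hp
    linear_combination (1/2 : ℂ) * hp
  obtain ⟨w, hw, hwb⟩ : ∃ w : ℂ, w * star w = 1 ∧ M 0 1 * star w = M' 0 1 := by
    by_cases h : M 0 1 = 0
    · refine ⟨1, by simp, ?_⟩
      rw [h] at hb
      simp at hb
      simp [h, hb]
    · have h2 : star (M 0 1) ≠ 0 := star_ne_zero.2 h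
      refine ⟨star (M' 0 1) / star (M 0 1), ?_, ?_⟩
      · rw [star_div₀, star_star, star_star]
        field_simp
        linear_combination -hb
      · rw [star_div₀, star_star, star_star]
        field_simp
  have hwc : w * M 1 0 = M' 1 0 := by
    rw [← e1, ← e2, ← hwb]; simp [mul_comm]
  have hw' : w * (starRingEnd ℂ) w = 1 := hw
  have hwb' : M 0 1 * (starRingEnd ℂ) w = M' 0 1 := hwb
  refine ⟨diagonal ![1, w], ?_, ?_, ?_⟩
  · ext i j; fin_cases i <;> fin_cases j <;> simp [diagonal_conjTranspose, hw']
  · ext i j; fin_cases i <;> fin_cases j <;> simp [diagonal_conjTranspose]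
    linear_combination d 1 * hw'
  · ext i j; fin_cases i <;> fin_cases j <;> simp [diagonal_conjTranspose, hwb', hwc, a0]
    linear_combination M 1 1 * hw' + a1

lemma aux_half (z : ℂ) (h : 0 ≤ 2 * z) : 0 ≤ z := by
  rw [Complex.le_def] at h ⊢
  simp at h ⊢
  exact ⟨h.1, h.2.symm⟩

/-- trace form of the Kadison inequality -/
lemma aux_kad (k : ℕ) (K : Fin k → Matrix (Fin 2) (Fin 2) ℂ) (h : ∑ i, K i * (K i)ᴴ = 1)
    (X Y : Matrix (Fin 2) (Fin 2) ℂ) (hX : X.IsHermitian) (hY : Y.IsHermitian)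
    (ht : X.trace = 0) (hXY : ∑ i, K i * X * (K i)ᴴ = Y) :
    (Y * Y).trace ≤ (X * X).trace := by
  have hXX : X * X = ((X * X).trace / 2) • (1 : Matrix (Fin 2) (Fin 2) ℂ) := by
    have h11 : X 1 1 = - X 0 0 := by
      rw [Matrix.trace_fin_two] at ht; linear_combination ht
    ext i j; fin_cases i <;> fin_cases j <;>
      simp [Matrix.trace_fin_two, Matrix.mul_apply, Fin.sum_univ_two, h11] <;> ring
  have key : ∑ i, (K i * X - Y * K i) * (K i * X - Y * K i)ᴴ
      = ((X * X).trace / 2) • (1 : Matrix (Fin 2) (Fin 2) ℂ) - Y * Y := by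
    have : ∀ i, (K i * X - Y * K i) * (K i * X - Y * K i)ᴴ =
        ((X * X).trace / 2) • (K i * (K i)ᴴ) - (K i * X * (K i)ᴴ) * Y
          - Y * (K i * X * (K i)ᴴ) + Y * (K i * (K i)ᴴ) * Y := by
      intro i
      have e : K i * (X * X) * (K i)ᴴ = ((X * X).trace / 2) • (K i * (K i)ᴴ) := by
        conv_lhs => rw [hXX]
        simp
      rw [← e, conjTranspose_sub, conjTranspose_mul, conjTranspose_mul, hX.eq, hY.eq]
      noncomm_ring
    simp_rw [this]
    rw [Finset.sum_add_distrib, Finset.sum_sub_distrib, Finset.sum_sub_distrib, ← Finset.smul_sum,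
      ← Finset.sum_mul, ← Finset.mul_sum, ← Finset.sum_mul, ← Finset.mul_sum, h, hXY]
    noncomm_ring
  have pos : (0 : ℂ) ≤ (∑ i, (K i * X - Y * K i) * (K i * X - Y * K i)ᴴ).trace := by
    rw [trace_sum]
    exact Finset.sum_nonneg fun i _ => (posSemidef_self_mul_conjTranspose _).trace_nonneg
  rw [key] at pos
  simp only [trace_sub, trace_smul, trace_one, Fintype.card_fin, smul_eq_mul] at pos
  have : (X * X).trace / 2 * ((2 : ℕ) : ℂ) = (X * X).trace := by push_cast; ring
  rw [this] at pos
  exact sub_nonneg.1 pos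

/-- For qubit observable pairs with equal traces `2` and equal purities, a unital CP map
converting `(L₀, L₁)` into `(L₀', L₁')` exists if and only if the overlaps agree:
`tr(L₀L₁) = tr(L₀'L₁')`. -/
theorem stmt_16 (L₀ L₁ L₀' L₁' : Matrix (Fin 2) (Fin 2) ℂ)
    (h0 : L₀.PosSemidef) (h1 : L₁.PosSemidef)
    (h0' : L₀'.PosSemidef) (h1' : L₁'.PosSemidef)
    (ht0 : L₀.trace = 2) (ht1 : L₁.trace = 2)
    (ht0' : L₀'.trace = 2) (ht1' : L₁'.trace = 2)
    (hp1 : (L₀ * L₀).trace = (L₁ * L₁).trace)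
    (hp2 : (L₁ * L₁).trace = (L₀' * L₀').trace)
    (hp3 : (L₀' * L₀').trace = (L₁' * L₁').trace) :
    (∃ (k : ℕ) (K : Fin k → Matrix (Fin 2) (Fin 2) ℂ),
        (∑ i, K i * (K i)ᴴ = 1) ∧
        (∑ i, K i * L₀ * (K i)ᴴ = L₀') ∧ (∑ i, K i * L₁ * (K i)ᴴ = L₁')) ↔
      (L₀ * L₁).trace = (L₀' * L₁').trace := by
  constructor
  · rintro ⟨k, K, hK, hK0, hK1⟩
    have i1 := aux_kad k K hK (L₀ - L₁) (L₀' - L₁') (h0.1.sub h1.1) (h0'.1.sub h1'.1)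
      (by rw [trace_sub, ht0, ht1, sub_self])
      (by simp only [mul_sub, sub_mul, Finset.sum_sub_distrib, hK0, hK1])
    have h2 : (1 + 1 : Matrix (Fin 2) (Fin 2) ℂ).IsHermitian := isHermitian_one.add isHermitian_one
    have i2 := aux_kad k K hK (L₀ + L₁ - (1 + 1)) (L₀' + L₁' - (1 + 1))
      ((h0.1.add h1.1).sub h2) ((h0'.1.add h1'.1).sub h2)
      (by rw [trace_sub, trace_add, trace_add, ht0, ht1, trace_one]; simp)
      (by simp only [mul_sub, sub_mul, mul_add, add_mul, mul_one, Finset.sum_sub_distrib,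
            Finset.sum_add_distrib, hK0, hK1, hK])
    have c := trace_mul_comm L₀ L₁
    have c' := trace_mul_comm L₀' L₁'
    simp only [mul_sub, sub_mul, mul_add, add_mul, mul_one, one_mul, trace_sub, trace_add,
      ht0, ht1, ht0', ht1', hp1, hp2, hp3, ← c, ← c'] at i1 i2
    apply le_antisymm
    · have : 0 ≤ 2 * ((L₀' * L₁').trace - (L₀ * L₁).trace) := by
        have := sub_nonneg.2 i1
        ring_nf at this ⊢; exact this
      exact sub_nonneg.1 (aux_half _ this)
    · have : 0 ≤ 2 * ((L₀ * L₁).trace - (L₀' * L₁').trace) := by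
        have := sub_nonneg.2 i2
        ring_nf at this ⊢; exact this
      exact sub_nonneg.1 (aux_half _ this)
  · intro ho
    suffices h : ∃ U : Matrix (Fin 2) (Fin 2) ℂ, U * Uᴴ = 1 ∧ U * L₀ * Uᴴ = L₀' ∧
        U * L₁ * Uᴴ = L₁' by
      obtain ⟨U, a, b, c⟩ := h
      exact ⟨1, fun _ => U, by simpa using a, by simpa using b, by simpa using c⟩
    have s1 := aux_spec L₁ L₀ h1.1 h0.1 (ht1.trans ht0.symm) hp1.symm
    have s2 := aux_spec L₀' L₀ h0'.1 h0.1 (ht0'.trans ht0.symm) (hp1.trans hp2).symm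
    have s3 := aux_spec L₁' L₀ h1'.1 h0.1 (ht1'.trans ht0.symm) ((hp1.trans hp2).trans hp3).symm
    obtain ⟨V, v1, v2, v3⟩ := aux_diag L₀ h0.1
    obtain ⟨V', v1', v2', v3'⟩ := aux_diag L₀' h0'.1
    rw [s2] at v3'
    obtain ⟨d, hd⟩ : ∃ d : Fin 2 → ℂ, d = fun i => (h0.1.eigenvalues i : ℂ) := ⟨_, rfl⟩
    rw [← hd] at v3 v3'
    by_cases hne : d 0 = d 1
    · have hD : diagonal d = d 0 • (1 : Matrix (Fin 2) (Fin 2) ℂ) := by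
        ext i j; fin_cases i <;> fin_cases j <;> simp [hne]
      obtain ⟨V1, w1, w2, w3⟩ := aux_diag L₁ h1.1
      obtain ⟨V1', w1', w2', w3'⟩ := aux_diag L₁' h1'.1
      rw [s1, ← hd] at w3
      rw [s3, ← hd] at w3'
      rw [hD] at v3 v3' w3 w3'
      simp only [Matrix.mul_smul, mul_one, Matrix.smul_mul, v1, v1', w1, w1'] at v3 v3' w3 w3'
      exact ⟨1, by simp, by simp [v3, v3'], by simp [w3, w3']⟩
    · have tc : ∀ (P A : Matrix (Fin 2) (Fin 2) ℂ), P * Pᴴ = 1 → (Pᴴ * A * P).trace = A.trace := by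
        intro P A hP
        rw [trace_mul_comm, ← mul_assoc, hP, one_mul]
      have cm : ∀ (P A B : Matrix (Fin 2) (Fin 2) ℂ), P * Pᴴ = 1 →
          (Pᴴ * A * P) * (Pᴴ * B * P) = Pᴴ * (A * B) * P := by
        intro P A B hP
        calc _ = Pᴴ * A * (P * Pᴴ) * B * P := by noncomm_ring
          _ = _ := by rw [hP]; noncomm_ring
      have dd : ∀ (P A : Matrix (Fin 2) (Fin 2) ℂ), Pᴴ * P = 1 → A = P * diagonal d * Pᴴ →
          diagonal d = Pᴴ * A * P := by
        intro P A hP hA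
        calc _ = (Pᴴ * P) * diagonal d * (Pᴴ * P) := by rw [hP]; simp
          _ = _ := by rw [hA]; noncomm_ring
      obtain ⟨W, x1, x2, x3⟩ := aux_phase d hne (Vᴴ * L₁ * V) (V'ᴴ * L₁' * V')
        (isHermitian_conjTranspose_mul_mul _ h1.1) (isHermitian_conjTranspose_mul_mul _ h1'.1)
        (by rw [tc _ _ v1, tc _ _ v1', ht1, ht1'])
        (by rw [cm _ _ _ v1, cm _ _ _ v1', tc _ _ v1, tc _ _ v1', hp2, hp3])
        (by
          conv_lhs => rw [dd V L₀ v2 v3, cm _ _ _ v1, tc _ _ v1]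
          conv_rhs => rw [dd V' L₀' v2' v3', cm _ _ _ v1', tc _ _ v1']
          exact ho)
      refine ⟨V' * W * Vᴴ, ?_, ?_, ?_⟩
      · simp only [conjTranspose_mul, conjTranspose_conjTranspose]
        calc _ = V' * W * (Vᴴ * V) * Wᴴ * V'ᴴ := by noncomm_ring
          _ = V' * (W * Wᴴ) * V'ᴴ := by rw [v2]; noncomm_ring
          _ = 1 := by rw [x1, mul_one, v1']
      · simp only [conjTranspose_mul, conjTranspose_conjTranspose]
        calc _ = V' * (W * (Vᴴ * L₀ * V) * Wᴴ) * V'ᴴ := by noncomm_ring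
          _ = _ := by rw [← dd V L₀ v2 v3, x2, ← v3']
      · simp only [conjTranspose_mul, conjTranspose_conjTranspose]
        calc _ = V' * (W * (Vᴴ * L₁ * V) * Wᴴ) * V'ᴴ := by noncomm_ring
          _ = (V' * V'ᴴ) * L₁' * (V' * V'ᴴ) := by rw [x3]; noncomm_ring
          _ = _ := by rw [v1']; simp
end

section
/- Let M be a Hermitian 2×2 matrix over ℂ and L a Hermitian 2×2 matrix. Then the following are equivalent: (i) there exists a Hermitian 2×2 matrix B such that L − (i·(B·M − M·B) + B²) is positive semidefinite; (ii) there exists a Hermitian 2×2 matrix B such that L = i·(B·M − M·B) + B². In other words, the upward closure (with respect to the positive semidefinite order) of the set { i·[B,M] + B² : B Hermitian } equals that set itself. -/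
open Matrix ComplexOrder

/-- Pauli coordinates of a Hermitian 2×2 matrix. -/
noncomputable def pauliH (a x y z : ℝ) : Matrix (Fin 2) (Fin 2) ℂ :=
  !![(a : ℂ) + z, x - y * Complex.I; x + y * Complex.I, a - z]

lemma pauliH_herm (a x y z : ℝ) : (pauliH a x y z).IsHermitian := by
  ext i j
  fin_cases i <;> fin_cases j <;>
    simp [pauliH, Matrix.conjTranspose_apply, Complex.ext_iff]

lemma exists_pauliH (A : Matrix (Fin 2) (Fin 2) ℂ) (hA : A.IsHermitian) :
    ∃ a x y z : ℝ, A = pauliH a x y z := by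
  have h00 := congrArg Complex.im (hA.apply 0 0)
  have h11 := congrArg Complex.im (hA.apply 1 1)
  have h01r := congrArg Complex.re (hA.apply 0 1)
  have h01i := congrArg Complex.im (hA.apply 0 1)
  simp at h00 h11 h01r h01i
  refine ⟨((A 0 0).re + (A 1 1).re) / 2, (A 1 0).re, (A 1 0).im,
    ((A 0 0).re - (A 1 1).re) / 2, ?_⟩
  ext i j
  fin_cases i <;> fin_cases j <;> apply Complex.ext <;> simp [pauliH] <;> linarith

lemma pauliH_formula (m μ s x y z : ℝ) :
    Complex.I • (pauliH s x y z * pauliH m 0 0 μ - pauliH m 0 0 μ * pauliH s x y z)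
      + pauliH s x y z * pauliH s x y z
      = pauliH (s ^ 2 + x ^ 2 + y ^ 2 + z ^ 2) (2 * (s * x - μ * y)) (2 * (s * y + μ * x))
          (2 * (s * z)) := by
  ext i j
  fin_cases i <;> fin_cases j <;> apply Complex.ext <;>
    simp [pauliH, pow_two] <;> ring

lemma pauliH_sub (a x y z a' x' y' z' : ℝ) :
    pauliH a x y z - pauliH a' x' y' z' = pauliH (a - a') (x - x') (y - y') (z - z') := by
  ext i j
  fin_cases i <;> fin_cases j <;> apply Complex.ext <;> simp [pauliH] <;> ring

lemma pauliH_psd (a x y z : ℝ) (h : (pauliH a x y z).PosSemidef) :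
    0 ≤ a ∧ x ^ 2 + y ^ 2 + z ^ 2 ≤ a ^ 2 := by
  have h1 := (Complex.le_def.1 h.trace_nonneg).1
  have h2 := (Complex.le_def.1 h.det_nonneg).1
  simp [pauliH, Matrix.trace, Fin.sum_univ_two, Matrix.det_fin_two] at h1 h2
  constructor <;> nlinarith

/-- weak duality -/
lemma weak_dual (l0 l1 l2 l3 μ s x y z w1 w2 w3 : ℝ)
    (hR : 0 ≤ l0 - (s ^ 2 + x ^ 2 + y ^ 2 + z ^ 2))
    (h : (l1 - 2 * (s * x - μ * y)) ^ 2 + (l2 - 2 * (s * y + μ * x)) ^ 2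
      + (l3 - 2 * (s * z)) ^ 2 ≤ (l0 - (s ^ 2 + x ^ 2 + y ^ 2 + z ^ 2)) ^ 2)
    (hw : w1 ^ 2 + w2 ^ 2 + w3 ^ 2 ≤ 1) :
    l1 * w1 + l2 * w2 + l3 * w3 - μ ^ 2 * (w1 ^ 2 + w2 ^ 2) ≤ l0 := by
  set R := l0 - (s ^ 2 + x ^ 2 + y ^ 2 + z ^ 2) with hRd
  obtain ⟨r1, h1⟩ : ∃ r, r = l1 - 2 * (s * x - μ * y) := ⟨_, rfl⟩
  obtain ⟨r2, h2⟩ : ∃ r, r = l2 - 2 * (s * y + μ * x) := ⟨_, rfl⟩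
  obtain ⟨r3, h3⟩ : ∃ r, r = l3 - 2 * (s * z) := ⟨_, rfl⟩
  rw [← h1, ← h2, ← h3] at h
  have key : r1 * w1 + r2 * w2 + r3 * w3 ≤ R := by
    refine (abs_le_of_sq_le_sq' ?_ hR).2
    have cs : (r1 * w1 + r2 * w2 + r3 * w3) ^ 2
        ≤ (r1 ^ 2 + r2 ^ 2 + r3 ^ 2) * (w1 ^ 2 + w2 ^ 2 + w3 ^ 2) := by
      nlinarith [sq_nonneg (r1 * w2 - r2 * w1), sq_nonneg (r1 * w3 - r3 * w1),
        sq_nonneg (r2 * w3 - r3 * w2)]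
    have : (r1 ^ 2 + r2 ^ 2 + r3 ^ 2) * (w1 ^ 2 + w2 ^ 2 + w3 ^ 2)
        ≤ (r1 ^ 2 + r2 ^ 2 + r3 ^ 2) * 1 := by
      apply mul_le_mul_of_nonneg_left hw; positivity
    linarith
  have e1 : l1 = r1 + 2 * (s * x - μ * y) := by linarith
  have e2 : l2 = r2 + 2 * (s * y + μ * x) := by linarith
  have e3 : l3 = r3 + 2 * (s * z) := by linarith
  have hs : s ^ 2 * (w1 ^ 2 + w2 ^ 2 + w3 ^ 2) ≤ s ^ 2 * 1 :=
    mul_le_mul_of_nonneg_left hw (sq_nonneg s)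
  rw [e1, e2, e3]
  nlinarith [sq_nonneg (x - (s * w1 + μ * w2)), sq_nonneg (y - (s * w2 - μ * w1)),
    sq_nonneg (z - s * w3)]

/-- the interior case -/
lemma interior_case (l0 l1 l2 l3 μ : ℝ)
    (H : ∀ w1 w2 w3 : ℝ, w1 ^ 2 + w2 ^ 2 + w3 ^ 2 ≤ 1 →
      l1 * w1 + l2 * w2 + l3 * w3 - μ ^ 2 * (w1 ^ 2 + w2 ^ 2) ≤ l0)
    (τ : ℝ) (hτ : 0 < τ)
    (he : l3 ^ 2 / (4 * τ ^ 2) + (l1 ^ 2 + l2 ^ 2) / (4 * (τ + μ ^ 2) ^ 2) = 1) :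
    ∃ s x y z : ℝ, l0 = s ^ 2 + x ^ 2 + y ^ 2 + z ^ 2 ∧ l1 = 2 * (s * x - μ * y) ∧
      l2 = 2 * (s * y + μ * x) ∧ l3 = 2 * (s * z) := by
  have hτμ : 0 < τ + μ ^ 2 := by positivity
  set h : ℝ → ℝ := fun t => t + l3 ^ 2 / (4 * t) + (l1 ^ 2 + l2 ^ 2) / (4 * (t + μ ^ 2)) with hh
  have hle : h τ ≤ l0 := by
    obtain ⟨u, hu⟩ : ∃ u, u = τ + μ ^ 2 := ⟨_, rfl⟩
    have hμ : μ ^ 2 = u - τ := by linarith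
    have := H (l1 / (2 * (τ + μ ^ 2))) (l2 / (2 * (τ + μ ^ 2))) (l3 / (2 * τ)) (by
      rw [← he]; apply le_of_eq; field_simp; ring)
    refine le_trans (le_of_eq ?_) this
    have e : h τ = τ * (l3 ^ 2 / (4 * τ ^ 2) + (l1 ^ 2 + l2 ^ 2) / (4 * (τ + μ ^ 2) ^ 2))
        + l3 ^ 2 / (4 * τ) + (l1 ^ 2 + l2 ^ 2) / (4 * (τ + μ ^ 2)) := by
      rw [he, hh]; ring
    rw [e]
    simp only [← hu, hμ] at hτμ ⊢
    field_simp
    ring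
  have hcont : ContinuousOn h (Set.Icc τ l0) := by
    intro t ht
    have h1 : 0 < t := lt_of_lt_of_le hτ ht.1
    have h2 : 4 * (t + μ ^ 2) ≠ 0 := by positivity
    have h3 : 4 * t ≠ 0 := by positivity
    apply ContinuousAt.continuousWithinAt
    have c1 : ContinuousAt (fun t : ℝ => l3 ^ 2 / (4 * t)) t :=
      ContinuousAt.div (by fun_prop) (by fun_prop) h3
    have c2 : ContinuousAt (fun t : ℝ => (l1 ^ 2 + l2 ^ 2) / (4 * (t + μ ^ 2))) t :=
      ContinuousAt.div (by fun_prop) (by fun_prop) h2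
    exact (continuousAt_id.add c1).add c2
  have hge : ∀ t, 0 < t → t ≤ h t := by
    intro t ht
    have : 0 ≤ l3 ^ 2 / (4 * t) := by positivity
    have : 0 ≤ (l1 ^ 2 + l2 ^ 2) / (4 * (t + μ ^ 2)) := by positivity
    simp only [hh]; linarith
  have hτl : τ ≤ l0 := (hge τ hτ).trans hle
  obtain ⟨t, ht, hte⟩ := intermediate_value_Icc hτl hcont ⟨hle, hge l0 (hτ.trans_le hτl)⟩
  have ht0 : 0 < t := lt_of_lt_of_le hτ ht.1
  obtain ⟨s, hs, hst⟩ : ∃ s : ℝ, 0 < s ∧ t = s ^ 2 :=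
    ⟨√t, Real.sqrt_pos.2 ht0, (Real.sq_sqrt ht0.le).symm⟩
  have hsμ : s ^ 2 + μ ^ 2 ≠ 0 := by positivity
  refine ⟨s, (s * l1 + μ * l2) / (2 * (s ^ 2 + μ ^ 2)), (s * l2 - μ * l1) / (2 * (s ^ 2 + μ ^ 2)),
    l3 / (2 * s), ?_, ?_, ?_, ?_⟩
  · rw [← hte, hh, hst]
    field_simp
    ring
  · field_simp; ring
  · field_simp; ring
  · field_simp

lemma real_main (l0 l1 l2 l3 μ : ℝ)
    (H : ∀ w1 w2 w3 : ℝ, w1 ^ 2 + w2 ^ 2 + w3 ^ 2 ≤ 1 →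
      l1 * w1 + l2 * w2 + l3 * w3 - μ ^ 2 * (w1 ^ 2 + w2 ^ 2) ≤ l0) :
    ∃ s x y z : ℝ, l0 = s ^ 2 + x ^ 2 + y ^ 2 + z ^ 2 ∧ l1 = 2 * (s * x - μ * y) ∧
      l2 = 2 * (s * y + μ * x) ∧ l3 = 2 * (s * z) := by
  by_cases h3 : l3 = 0
  · subst h3
    obtain ⟨q, hq0, hq⟩ : ∃ q : ℝ, 0 ≤ q ∧ l1 ^ 2 + l2 ^ 2 = q ^ 2 :=
      ⟨√(l1 ^ 2 + l2 ^ 2), Real.sqrt_nonneg _, (Real.sq_sqrt (by positivity)).symm⟩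
    by_cases hqm : q / 2 ≤ μ ^ 2
    · by_cases hμ : μ = 0
      · subst hμ
        have hq' : q = 0 := by nlinarith
        subst hq'
        have hl1 : l1 = 0 := by nlinarith
        have hl2 : l2 = 0 := by nlinarith
        have h0 : 0 ≤ l0 := by simpa using H 0 0 0 (by norm_num)
        refine ⟨√l0, 0, 0, 0, ?_, ?_, ?_, ?_⟩
        · rw [Real.sq_sqrt h0]; ring
        all_goals simp [hl1, hl2]
      · have hb : q ^ 2 / (4 * μ ^ 2) ≤ l0 := by
          have := H (l1 / (2 * μ ^ 2)) (l2 / (2 * μ ^ 2)) 0 (by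
            have : (l1 / (2 * μ ^ 2)) ^ 2 + (l2 / (2 * μ ^ 2)) ^ 2 + 0 ^ 2
                = q ^ 2 / (2 * μ ^ 2) ^ 2 := by
              rw [← hq]; field_simp; ring
            rw [this, div_le_one (by positivity)]
            apply pow_le_pow_left₀ hq0; linarith)
          refine le_trans (le_of_eq ?_) this
          rw [← hq]; field_simp; ring
        refine ⟨0, l2 / (2 * μ), -l1 / (2 * μ), √(l0 - q ^ 2 / (4 * μ ^ 2)), ?_, ?_, ?_, ?_⟩
        · rw [Real.sq_sqrt (by linarith), ← hq]; field_simp; ring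
        · field_simp; ring
        · field_simp; ring
        · simp
    · push Not at hqm
      have hqp : 0 < q := by nlinarith [sq_nonneg μ]
      apply interior_case l0 l1 l2 0 μ H (q / 2 - μ ^ 2) (by linarith)
      rw [hq]
      have : q / 2 - μ ^ 2 + μ ^ 2 = q / 2 := by ring
      rw [this]; field_simp; norm_num
  · obtain ⟨p, hp⟩ : ∃ p, p = |l3| := ⟨_, rfl⟩
    have hp0 : 0 < p := by rw [hp]; positivity
    have hl3 : l3 ^ 2 = p ^ 2 := by rw [hp, sq_abs]
    obtain ⟨Q, hQ⟩ : ∃ Q, Q = l1 ^ 2 + l2 ^ 2 := ⟨_, rfl⟩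
    have hQ0 : 0 ≤ Q := by rw [hQ]; positivity
    have hle : p / 2 ≤ p + Q + 1 := by linarith
    have hcont : ContinuousOn (fun t : ℝ => p ^ 2 / (4 * t ^ 2) + Q / (4 * (t + μ ^ 2) ^ 2))
        (Set.Icc (p / 2) (p + Q + 1)) := by
      intro t ht
      have h1 : 0 < t := lt_of_lt_of_le (by positivity) ht.1
      have h2 : 4 * (t + μ ^ 2) ^ 2 ≠ 0 := by positivity
      have h3 : 4 * t ^ 2 ≠ 0 := by positivity
      apply ContinuousAt.continuousWithinAt
      have c1 : ContinuousAt (fun t : ℝ => p ^ 2 / (4 * t ^ 2)) t :=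
        ContinuousAt.div (by fun_prop) (by fun_prop) h3
      have c2 : ContinuousAt (fun t : ℝ => Q / (4 * (t + μ ^ 2) ^ 2)) t :=
        ContinuousAt.div (by fun_prop) (by fun_prop) h2
      exact c1.add c2
    have hmem : (1 : ℝ) ∈ Set.Icc (p ^ 2 / (4 * (p + Q + 1) ^ 2)
        + Q / (4 * (p + Q + 1 + μ ^ 2) ^ 2))
        (p ^ 2 / (4 * (p / 2) ^ 2) + Q / (4 * (p / 2 + μ ^ 2) ^ 2)) := by
      constructor
      · have a1 : p ^ 2 / (4 * (p + Q + 1) ^ 2) ≤ 1 / 2 := by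
          rw [div_le_iff₀ (by positivity)]; nlinarith [mul_nonneg hp0.le hQ0]
        have a2 : Q / (4 * (p + Q + 1 + μ ^ 2) ^ 2) ≤ 1 / 2 := by
          rw [div_le_iff₀ (by positivity)]
          have : 1 * (Q + 1) ≤ (p + Q + 1 + μ ^ 2) * (p + Q + 1 + μ ^ 2) := by
            apply mul_le_mul <;> nlinarith [sq_nonneg μ]
          nlinarith
        linarith
      · have a1 : p ^ 2 / (4 * (p / 2) ^ 2) = 1 := by field_simp; norm_num
        have a2 : 0 ≤ Q / (4 * (p / 2 + μ ^ 2) ^ 2) := by positivity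
        linarith
    obtain ⟨t, ht, hte⟩ := intermediate_value_Icc' hle hcont hmem
    apply interior_case l0 l1 l2 l3 μ H t (lt_of_lt_of_le (by positivity) ht.1)
    rw [hl3, ← hQ]; exact hte

lemma diag_case (m μ : ℝ) (L B : Matrix (Fin 2) (Fin 2) ℂ) (hL : L.IsHermitian)
    (hB : B.IsHermitian)
    (h : (L - (Complex.I • (B * pauliH m 0 0 μ - pauliH m 0 0 μ * B) + B * B)).PosSemidef) :
    ∃ B : Matrix (Fin 2) (Fin 2) ℂ, B.IsHermitian ∧
        L = Complex.I • (B * pauliH m 0 0 μ - pauliH m 0 0 μ * B) + B * B := by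
  obtain ⟨l0, l1, l2, l3, rfl⟩ := exists_pauliH L hL
  obtain ⟨s, x, y, z, rfl⟩ := exists_pauliH B hB
  rw [pauliH_formula, pauliH_sub] at h
  obtain ⟨h1, h2⟩ := pauliH_psd _ _ _ _ h
  obtain ⟨s', x', y', z', e0, e1, e2, e3⟩ := real_main l0 l1 l2 l3 μ
    (fun w1 w2 w3 hw => weak_dual l0 l1 l2 l3 μ s x y z w1 w2 w3 h1 h2 hw)
  refine ⟨pauliH s' x' y' z', pauliH_herm _ _ _ _, ?_⟩
  rw [pauliH_formula, ← e0, ← e1, ← e2, ← e3]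

lemma conj_formula (U V B D : Matrix (Fin 2) (Fin 2) ℂ) (hVU : V * U = 1) :
    U * (Complex.I • (B * D - D * B) + B * B) * V
      = Complex.I • ((U * B * V) * (U * D * V) - (U * D * V) * (U * B * V))
        + (U * B * V) * (U * B * V) := by
  have h : ∀ X Y : Matrix (Fin 2) (Fin 2) ℂ, (U * X * V) * (U * Y * V) = U * (X * Y) * V := by
    intro X Y
    calc (U * X * V) * (U * Y * V) = U * X * (V * U) * Y * V := by simp only [Matrix.mul_assoc]
      _ = _ := by rw [hVU]; simp only [Matrix.mul_assoc, Matrix.mul_one, Matrix.one_mul]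
  rw [h, h, h]
  simp only [Matrix.mul_add, Matrix.add_mul, Matrix.mul_sub, Matrix.sub_mul, Matrix.mul_smul,
    Matrix.smul_mul]

/-- For 2×2 Hermitian `M`, the set `{ i[B,M] + B² : B Hermitian }` is upward closed in the
positive semidefinite order: `L` dominates some such element iff `L` is itself one. -/
theorem stmt_18 (M L : Matrix (Fin 2) (Fin 2) ℂ)
    (hM : M.IsHermitian) (hL : L.IsHermitian) :
    (∃ B : Matrix (Fin 2) (Fin 2) ℂ, B.IsHermitian ∧
        (L - (Complex.I • (B * M - M * B) + B * B)).PosSemidef) ↔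
      (∃ B : Matrix (Fin 2) (Fin 2) ℂ, B.IsHermitian ∧
        L = Complex.I • (B * M - M * B) + B * B) := by
  constructor
  swap
  · rintro ⟨B, hB, rfl⟩
    exact ⟨B, hB, by rw [sub_self]; exact Matrix.PosSemidef.zero⟩
  rintro ⟨B, hB, h⟩
  obtain ⟨U, m, μ, hU1, hU2, hUM⟩ : ∃ (U : Matrix (Fin 2) (Fin 2) ℂ) (m μ : ℝ),
      Uᴴ * U = 1 ∧ U * Uᴴ = 1 ∧ M = U * pauliH m 0 0 μ * Uᴴ := by
    refine ⟨hM.eigenvectorUnitary, (hM.eigenvalues 0 + hM.eigenvalues 1) / 2,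
      (hM.eigenvalues 0 - hM.eigenvalues 1) / 2, ?_, ?_, ?_⟩
    · exact Unitary.coe_star_mul_self hM.eigenvectorUnitary
    · exact Unitary.coe_mul_star_self hM.eigenvectorUnitary
    · have hd : pauliH ((hM.eigenvalues 0 + hM.eigenvalues 1) / 2) 0 0
          ((hM.eigenvalues 0 - hM.eigenvalues 1) / 2)
          = diagonal (RCLike.ofReal ∘ hM.eigenvalues) := by
        ext i j
        fin_cases i <;> fin_cases j <;> simp [pauliH] <;> ring
      rw [hd]
      have := hM.spectral_theorem
      rw [Unitary.conjStarAlgAut_apply] at this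
      exact this
  have hD : pauliH m 0 0 μ = Uᴴ * M * U := by
    rw [hUM]
    calc pauliH m 0 0 μ = (Uᴴ * U) * pauliH m 0 0 μ * (Uᴴ * U) := by rw [hU1]; simp
      _ = _ := by simp only [Matrix.mul_assoc]
  have h' := h.conjTranspose_mul_mul_same U
  rw [Matrix.mul_sub, Matrix.sub_mul, conj_formula Uᴴ U B M hU2, ← hD] at h'
  obtain ⟨B', hB', e⟩ := diag_case m μ _ _ (isHermitian_conjTranspose_mul_mul U hL)
    (isHermitian_conjTranspose_mul_mul U hB) h'
  refine ⟨U * B' * Uᴴ, isHermitian_mul_mul_conjTranspose U hB', ?_⟩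
  rw [hUM, ← conj_formula U Uᴴ B' _ hU1, ← e]
  calc L = (U * Uᴴ) * L * (U * Uᴴ) := by rw [hU2]; simp
    _ = _ := by simp only [Matrix.mul_assoc]
end

section
/- Define f₂ : ℝ² → ℝ by f₂(x,z) := √(x² + z²) − 1 if x² + z² ≥ 4 and f₂(x,z) := (x² + z²)/4 if x² + z² ≤ 4, and define D : ℝ³ → ℝ by D(x,z,w) := 16w⁴ + (−8x² + 8z² + 32)w³ + (x⁴ + 2x²z² − 32x² + z⁴ − 8z² + 16)w² + (10x⁴ + 2x²z² − 8x² − 8z⁴ − 32z²)w + (x⁴ − 3x⁴z² − x⁶ − 3x²z⁴ + 20x²z² − z⁶ − 8z⁴ − 16z²). Then for every x, z ∈ ℝ with z ≠ 0, there exists a unique w ∈ ℝ such that w ≥ f₂(x,z) and D(x,z,w) = 0. -/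
/-- The quartic discriminant polynomial `D(x,z,w)`. -/
def Dpoly (x z w : ℝ) : ℝ :=
  16 * w ^ 4 + (-8 * x ^ 2 + 8 * z ^ 2 + 32) * w ^ 3 +
    (x ^ 4 + 2 * x ^ 2 * z ^ 2 - 32 * x ^ 2 + z ^ 4 - 8 * z ^ 2 + 16) * w ^ 2 +
    (10 * x ^ 4 + 2 * x ^ 2 * z ^ 2 - 8 * x ^ 2 - 8 * z ^ 4 - 32 * z ^ 2) * w +
    (x ^ 4 - 3 * x ^ 4 * z ^ 2 - x ^ 6 - 3 * x ^ 2 * z ^ 4 + 20 * x ^ 2 * z ^ 2 -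
      z ^ 6 - 8 * z ^ 4 - 16 * z ^ 2)

/-- The function `f₂(x,z)`. -/
noncomputable def f2 (x z : ℝ) : ℝ :=
  if 4 ≤ x ^ 2 + z ^ 2 then Real.sqrt (x ^ 2 + z ^ 2) - 1 else (x ^ 2 + z ^ 2) / 4

theorem aux_lo (R Z t : ℝ) : ∀ x z : ℝ, x ^ 2 = R - Z → z ^ 2 = Z →
    Dpoly x z (R / 4 + t) = 16 * t ^ 4 + (16 * Z + 8 * R + 32) * t ^ 3 +
      (12 * Z * R + 24 * Z + (R - 4) ^ 2) * t ^ 2 - 3 * Z * (4 - R) * (R + 2) * t -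
      (Z / 4 * (4 - R) ^ 3 + 27 * Z ^ 2) := by
  intro x z hx hz
  have h1 : x ^ 4 = (R - Z) ^ 2 := by rw [← hx]; ring
  have h2 : x ^ 6 = (R - Z) ^ 3 := by rw [← hx]; ring
  have h3 : z ^ 4 = Z ^ 2 := by rw [← hz]; ring
  have h4 : z ^ 6 = Z ^ 3 := by rw [← hz]; ring
  unfold Dpoly
  rw [h1, h2, h3, h4, hx, hz]
  ring

theorem aux_hi (r Z : ℝ) : ∀ x z : ℝ, x ^ 2 = r ^ 2 - Z → z ^ 2 = Z →
    Dpoly x z (r - 1) = -(2 * Z * (r - 2) ^ 3 + 27 * Z ^ 2) := by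
  intro x z hx hz
  have h1 : x ^ 4 = (r ^ 2 - Z) ^ 2 := by rw [← hx]; ring
  have h2 : x ^ 6 = (r ^ 2 - Z) ^ 3 := by rw [← hx]; ring
  have h3 : z ^ 4 = Z ^ 2 := by rw [← hz]; ring
  have h4 : z ^ 6 = Z ^ 3 := by rw [← hz]; ring
  unfold Dpoly
  rw [h1, h2, h3, h4, hx, hz]
  ring

theorem aux_fac (x z w m c : ℝ) (hz : z ^ 2 = 4 * m * c)
    (hx : x ^ 2 = 4 * w - 4 * m * c + 4 * (c + (1 - w - m) * m)) :
    Dpoly x z w = 16 * ((1 - w - m) ^ 2 - 4 * c) * (m ^ 2 - (1 - w - m) * m + c) ^ 2 := by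
  have h1 : x ^ 4 = (x ^ 2) ^ 2 := by ring
  have h2 : x ^ 6 = (x ^ 2) ^ 3 := by ring
  have h3 : z ^ 4 = (z ^ 2) ^ 2 := by ring
  have h4 : z ^ 6 = (z ^ 2) ^ 3 := by ring
  unfold Dpoly
  rw [h1, h2, h3, h4, hx, hz]
  ring

/-- A real root `-m` in `[-1,0)` of the underlying cubic; a zero of `D` pins it down. -/
theorem aux_root (x z w : ℝ) (hz : z ≠ 0) (hw : 1 ≤ w) (hD : Dpoly x z w = 0) :
    ∃ m : ℝ, 0 < m ∧ m ≤ 1 ∧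
      x ^ 2 * m = 4 * m * (1 - m) * (w + m) + z ^ 2 * (1 - m) ∧
      (w - 1 + m) ^ 2 * m = z ^ 2 := by
  have hZ : 0 < z ^ 2 := by positivity
  obtain ⟨m, ⟨hm0, hm1⟩, hm⟩ : ∃ m ∈ Set.Icc (0 : ℝ) 1,
      x ^ 2 * m - 4 * m * (1 - m) * (w + m) - z ^ 2 * (1 - m) = 0 := by
    have := intermediate_value_Icc (a := (0 : ℝ)) (b := 1) zero_le_one
      (f := fun m : ℝ => x ^ 2 * m - 4 * m * (1 - m) * (w + m) - z ^ 2 * (1 - m))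
      (by fun_prop)
    exact this ⟨by simp; positivity, by simp; positivity⟩
  have hmp : 0 < m := by
    rcases hm0.lt_or_eq with h | h
    · exact h
    · subst h; simp at hm; exact absurd hm hz
  refine ⟨m, hmp, hm1, by linarith, ?_⟩
  obtain ⟨c, hc⟩ : ∃ c : ℝ, z ^ 2 = 4 * m * c := ⟨z ^ 2 / (4 * m), by field_simp⟩
  have hcp : 0 < c := by
    rw [hc] at hZ
    exact pos_of_mul_pos_right hZ (by positivity)
  have hx : x ^ 2 = 4 * w - 4 * m * c + 4 * (c + (1 - w - m) * m) := by
    apply mul_right_cancel₀ hmp.ne'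
    rw [hc] at hm
    linarith
  have hf := aux_fac x z w m c hc hx
  rw [hD] at hf
  have hq : 0 < m ^ 2 - (1 - w - m) * m + c := by
    have : 0 ≤ (w - 1 + m) * m := mul_nonneg (by linarith) hm0
    nlinarith [sq_nonneg m]
  have h0 : (1 - w - m) ^ 2 - 4 * c = 0 := by
    rcases mul_eq_zero.1 hf.symm with h | h
    · linarith
    · exact absurd h (by positivity)
  rw [hc]
  linear_combination m * h0

theorem aux_uniq_hi (x z w1 w2 : ℝ) (hz : z ≠ 0) (h1 : 1 ≤ w1) (h12 : w1 < w2)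
    (hD1 : Dpoly x z w1 = 0) (hD2 : Dpoly x z w2 = 0) : False := by
  have hZ : 0 < z ^ 2 := by positivity
  obtain ⟨m, hm, hm1, hx1, hz1⟩ := aux_root x z w1 hz h1 hD1
  obtain ⟨n, hn, hn1, hx2, hz2⟩ := aux_root x z w2 hz (by linarith) hD2
  rcases le_or_gt m n with h | h
  · have : (w1 - 1 + m) ^ 2 * m < (w2 - 1 + n) ^ 2 * n := by
      have a : (w1 - 1 + m) ^ 2 < (w2 - 1 + n) ^ 2 := by
        apply pow_lt_pow_left₀ <;> first | linarith | norm_num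
      calc _ < (w2 - 1 + n) ^ 2 * m := by gcongr
        _ ≤ _ := by gcongr
    linarith
  · have e : z ^ 2 * (m - n) + 4 * m * n * ((1 - n) * (w2 + n) - (1 - m) * (w1 + m)) = 0 := by
      linear_combination n * hx1 - m * hx2
    have a : 0 < z ^ 2 * (m - n) := mul_pos hZ (by linarith)
    have b : 0 ≤ (1 - n) * (w2 + n) - (1 - m) * (w1 + m) := by
      have e2 : (1 - n) * (w2 + n) - (1 - m) * (w1 + m) =
        (1 - n) * (w2 - w1) + (m - n) * (w1 - 1 + m + n) := by ring
      rw [e2]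
      exact add_nonneg (mul_nonneg (by linarith) (by linarith))
        (mul_nonneg (by linarith) (by linarith))
    have : 0 ≤ 4 * m * n * ((1 - n) * (w2 + n) - (1 - m) * (w1 + m)) := by positivity
    linarith

theorem aux_uniq_lo (a b c d e t u : ℝ) (ha : 0 < a) (hb : 0 ≤ b) (hc : 0 ≤ c) (he : 0 < e)
    (ht : 0 ≤ t) (htu : t < u)
    (h1 : a * t ^ 4 + b * t ^ 3 + c * t ^ 2 - d * t - e = 0)
    (h2 : a * u ^ 4 + b * u ^ 3 + c * u ^ 2 - d * u - e = 0) : False := by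
  have key : a * (t * u) * (u ^ 3 - t ^ 3) + b * (t * u) * (u ^ 2 - t ^ 2)
      + c * (t * u) * (u - t) + e * (u - t) = 0 := by
    linear_combination t * h2 - u * h1
  have hu : 0 < u := by linarith
  have k3 : 0 ≤ u ^ 3 - t ^ 3 := sub_nonneg.2 (by gcongr)
  have k2 : 0 ≤ u ^ 2 - t ^ 2 := sub_nonneg.2 (by gcongr)
  have k1 : 0 < u - t := by linarith
  have : 0 < e * (u - t) := by positivity
  have : 0 ≤ a * (t * u) * (u ^ 3 - t ^ 3) := by positivity
  have : 0 ≤ b * (t * u) * (u ^ 2 - t ^ 2) := by positivity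
  have : 0 ≤ c * (t * u) * (u - t) := by positivity
  linarith

theorem aux_large (x z a : ℝ) : ∃ w, a ≤ w ∧ 0 ≤ Dpoly x z w := by
  have h : ∀ p q r s : ℝ, ∃ w, a ≤ w ∧ 0 ≤ 16 * w ^ 4 + p * w ^ 3 + q * w ^ 2 + r * w + s := by
    intro p q r s
    refine ⟨1 + |a| + |p| + |q| + |r| + |s|, ?_, ?_⟩
    · linarith [le_abs_self a, abs_nonneg p, abs_nonneg q, abs_nonneg r, abs_nonneg s]
    · set w := 1 + |a| + |p| + |q| + |r| + |s| with hw
      have ha := abs_nonneg a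
      have hp := abs_nonneg p
      have hq := abs_nonneg q
      have hr := abs_nonneg r
      have hs := abs_nonneg s
      have w1 : 1 ≤ w := by linarith
      have w0 : 0 ≤ w := by linarith
      have p1 : 0 ≤ (w + p) * w ^ 3 :=
        mul_nonneg (by linarith [neg_abs_le p]) (by positivity)
      have q1 : 0 ≤ (w + q) * w ^ 2 :=
        mul_nonneg (by linarith [neg_abs_le q]) (by positivity)
      have r1 : 0 ≤ (w + r) * w :=
        mul_nonneg (by linarith [neg_abs_le r]) (by positivity)
      have s1 : 0 ≤ w + s := by linarith [neg_abs_le s]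
      have e3 : w ^ 3 ≤ w ^ 4 := pow_le_pow_right₀ w1 (by norm_num)
      have e2 : w ^ 2 ≤ w ^ 4 := pow_le_pow_right₀ w1 (by norm_num)
      have e1 : w ≤ w ^ 4 := le_self_pow₀ w1 (by norm_num)
      have e0 : 0 ≤ w ^ 4 := by positivity
      linarith
  exact h _ _ _ _

theorem aux_exists_s19 (x z a : ℝ) (ha : Dpoly x z a ≤ 0) : ∃ w, a ≤ w ∧ Dpoly x z w = 0 := by
  obtain ⟨b, hab, hb⟩ := aux_large x z a
  obtain ⟨w, hw, h⟩ := intermediate_value_Icc hab (f := fun w => Dpoly x z w)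
    (by unfold Dpoly; fun_prop) ⟨ha, hb⟩
  exact ⟨w, hw.1, h⟩

/-- For every `x, z` with `z ≠ 0` there is a unique `w ≥ f₂(x,z)` with `D(x,z,w) = 0`. -/
theorem stmt_19 (x z : ℝ) (hz : z ≠ 0) :
    ∃! w : ℝ, f2 x z ≤ w ∧ Dpoly x z w = 0 := by
  have hZ : 0 < z ^ 2 := by positivity
  have hX : 0 ≤ x ^ 2 := by positivity
  have main : Dpoly x z (f2 x z) ≤ 0 ∧ ∀ w1 w2, f2 x z ≤ w1 → w1 < w2 →
      Dpoly x z w1 = 0 → Dpoly x z w2 = 0 → False := by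
    unfold f2
    split_ifs with h
    · set r := Real.sqrt (x ^ 2 + z ^ 2) with hr
      have hr2 : r ^ 2 = x ^ 2 + z ^ 2 := Real.sq_sqrt (by linarith)
      have h2 : 2 ≤ r := Real.le_sqrt_of_sq_le (by linarith)
      refine ⟨?_, fun w1 w2 a b c d => aux_uniq_hi x z w1 w2 hz (by linarith) b c d⟩
      rw [aux_hi r (z ^ 2) x z (by linarith) rfl]
      have : 0 ≤ r - 2 := by linarith
      have : 0 ≤ 2 * z ^ 2 * (r - 2) ^ 3 + 27 * (z ^ 2) ^ 2 := by positivity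
      linarith
    · push Not at h
      obtain ⟨R, hR⟩ : ∃ R, R = x ^ 2 + z ^ 2 := ⟨_, rfl⟩
      rw [← hR] at h ⊢
      have h4 : 0 < 4 - R := by linarith
      have hR0 : 0 ≤ R := by linarith
      have L := fun t => aux_lo R (z ^ 2) t x z (by linarith) rfl
      have he : 0 < z ^ 2 / 4 * (4 - R) ^ 3 + 27 * (z ^ 2) ^ 2 := by positivity
      constructor
      · have := L 0
        rw [add_zero] at this
        rw [this]
        linarith
      · intro w1 w2 a b c d
        have L1 := L (w1 - R / 4)
        have L2 := L (w2 - R / 4)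
        rw [add_sub_cancel] at L1 L2
        rw [c] at L1
        rw [d] at L2
        exact aux_uniq_lo _ _ _ _ _ (w1 - R / 4) (w2 - R / 4) (by norm_num) (by positivity)
          (by positivity) he (by linarith) (by linarith) L1.symm L2.symm
  obtain ⟨w, hw, hD⟩ := aux_exists_s19 x z _ main.1
  refine ⟨w, ⟨hw, hD⟩, ?_⟩
  rintro v ⟨hv, hDv⟩
  rcases lt_trichotomy v w with h | h | h
  · exact (main.2 v w hv h hDv hD).elim
  · exact h
  · exact (main.2 w v hw h hD hDv).elim
end
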